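/- arXiv:2010.10256 — 3 statements merged into one kernel-verified Lean document; each statement's English description precedes it below -/
import Mathlib

section
/- There is no integer N > 120 such that N + 1, 3·N + 1 and 8·N + 1 are all perfect squares. Equivalently, there is no integer N > 120 such that the product of any two distinct members of {1, 3, 8, N} increased by 1 is a perfect square. -/
open Pell NumberTheorySymbols

/-- The sequence `1, 2, 7, 26, 97, …` of the `x` for which `x ^ 2 - 3 * y ^ 2 = 1` is solvable. -/
abbrev pellX (n : ℕ) : ℕ := xn (one_lt_two : 1 < 2) n

lemma pellX_sq (n : ℕ) :
    pellX n * pellX n = 3 * yn (one_lt_two : 1 < 2) n * yn (one_lt_two : 1 < 2) n + 1 := by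
  have h := pell_eq (one_lt_two : 1 < 2) n
  change _ - 3 * _ * _ = 1 at h
  simp only [pellX]
  omega

lemma pellX_two_mul (n : ℕ) : pellX (2 * n) + 1 = 2 * pellX n ^ 2 := by
  have h := pellX_sq n
  have h₂ := xn_add (one_lt_two : 1 < 2) n n
  change _ = _ + 3 * _ * _ at h₂
  simp only [pellX, two_mul] at h ⊢
  rw [h₂]
  linarith

lemma pellX_two_mul_mod_two (n : ℕ) : pellX (2 * n) % 2 = 1 := by
  have := pellX_two_mul n
  omega

lemma pellX_two_mul_mod_three (n : ℕ) : pellX (2 * n) % 3 = 1 := by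
  have h := pellX_two_mul n
  rw [sq, pellX_sq, mul_assoc] at h
  omega

lemma pellX_four_mul_mul_add (k h j : ℕ) :
    pellX (4 * k * h + j) ≡ pellX j [MOD pellX k] := by
  induction h with
  | zero => simp [Nat.ModEq]
  | succ h ih =>
    rw [show 4 * k * (h + 1) + j = 4 * k + (4 * k * h + j) by ring]
    exact (xn_modEq_x4n_add _ _ _).trans ih

lemma pellX_dvd_of_eq_add {k g n j : ℕ} (hg : Odd g) (hn : n = 2 * k * g + j) :
    pellX k ∣ pellX n + pellX j := by
  obtain ⟨h, rfl⟩ := hg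
  rw [← Nat.modEq_zero_iff_dvd, hn,
    show 2 * k * (2 * h + 1) + j = 4 * k * h + (2 * k + j) by ring]
  exact ((pellX_four_mul_mul_add _ _ _).add_right _).trans (xn_modEq_x2n_add _ _ _)

lemma pellX_dvd_of_add_eq {k g n j : ℕ} (hg : Odd g) (hj : j ≤ 2 * k) (hn : n + j = 2 * k * g) :
    pellX k ∣ pellX n + pellX j := by
  obtain ⟨h, rfl⟩ := hg
  obtain rfl : n = 4 * k * h + (2 * k - j) := by
    have : 2 * k * (2 * h + 1) = 4 * k * h + 2 * k := by ring
    omega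
  rw [← Nat.modEq_zero_iff_dvd]
  exact ((pellX_four_mul_mul_add _ _ _).add_right _).trans (xn_modEq_x2n_sub _ hj)

lemma jacobiSym_neg_three {b : ℕ} (hb : Odd b) : J(-3 | b) = J(b | 3) := by
  rw [show (-3 : ℤ) = -1 * (3 : ℕ) by norm_num, jacobiSym.mul_left, jacobiSym.at_neg_one hb]
  rcases Nat.odd_mod_four_iff.mp (Nat.odd_iff.mp hb) with h | h
  · rw [ZMod.χ₄_nat_one_mod_four h, one_mul,
      jacobiSym.quadratic_reciprocity_one_mod_four' (by decide) h]
  · rw [ZMod.χ₄_nat_three_mod_four h,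
      jacobiSym.quadratic_reciprocity_three_mod_four rfl h, neg_one_mul, neg_neg]

/-- If `24 * X n - 39` is a square `w ^ 2` and `q = 8 * X j + 13` is a prime congruent to `1`
modulo `4`, then every `X (2 * k)` dividing `X n + X j` is a square modulo `q`. -/
lemma isSquare_pellX {n j k q : ℕ} [Fact q.Prime] {w : ℤ} (hw : w ^ 2 = 24 * pellX n - 39)
    (hq : q = 8 * pellX j + 13) (hq₄ : q % 4 = 1) (hdvd : pellX (2 * k) ∣ pellX n + pellX j) :
    IsSquare (pellX (2 * k) : ZMod q) := by
  by_contra hns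
  have hodd : Odd (pellX (2 * k)) := Nat.odd_iff.mpr (pellX_two_mul_mod_two k)
  have hJq : J(q | pellX (2 * k)) = -1 := by
    rw [jacobiSym.quadratic_reciprocity_one_mod_four hq₄ hodd,
      ZMod.nonsquare_iff_jacobiSym_eq_neg_one]
    exact_mod_cast hns
  have hJ₃ : J(-3 | pellX (2 * k)) = 1 := by
    rw [jacobiSym_neg_three hodd, jacobiSym.mod_left,
      show ((pellX (2 * k) : ℕ) : ℤ) % (3 : ℕ) = 1 by
        exact_mod_cast pellX_two_mul_mod_three k, jacobiSym.one_left]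
  have hJ : J(-3 * q | pellX (2 * k)) = -1 := by
    rw [jacobiSym.mul_left, hJ₃, hJq, one_mul]
  refine ZMod.nonsquare_of_jacobiSym_eq_neg_one hJ ⟨(w : ZMod _), ?_⟩
  rw [← Int.cast_mul, ZMod.intCast_eq_intCast_iff_dvd_sub]
  have : ((pellX (2 * k) : ℕ) : ℤ) ∣ pellX n + pellX j := by exact_mod_cast hdvd
  refine (this.mul_left 24).trans (dvd_of_eq ?_)
  rw [← sq, hw, hq]
  push_cast
  ring

lemma ZMod.pow_div_two_mod_ne_of_isSquare {p a : ℕ} [Fact p.Prime] (hp : p ≠ 2)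
    (ha : IsSquare (a : ZMod p)) : a ^ (p / 2) % p ≠ p - 1 := by
  intro h
  have hp₁ : 1 ≤ p := (Fact.out : p.Prime).one_le
  have : Fact (2 < p) := ⟨lt_of_le_of_ne (Fact.out : p.Prime).two_le hp.symm⟩
  have h₁ : (a : ZMod p) ^ (p / 2) = -1 := by
    rw [← Nat.cast_pow, ← ZMod.natCast_mod, h, Nat.cast_sub hp₁]
    simp
  by_cases h₀ : (a : ZMod p) = 0
  · rw [h₀, zero_pow (by have := (Fact.out : 2 < p); omega)] at h₁
    exact one_ne_zero (neg_eq_zero.mp h₁.symm)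
  · rw [(ZMod.euler_criterion p h₀).mp ha] at h₁
    exact ZMod.neg_one_ne_one h₁.symm

/-- The map `x ↦ 2 * x ^ 2 - 1` modulo `q`, which sends `X n` to `X (2 * n)`. -/
def doublingMap (q x : ℕ) : ℕ := (2 * x ^ 2 + (q - 1)) % q

lemma doublingMap_pellX_mod {q : ℕ} (hq : 0 < q) (n : ℕ) :
    doublingMap q (pellX n % q) = pellX (2 * n) % q := by
  have h : 2 * pellX n ^ 2 + (q - 1) = pellX (2 * n) + q := by
    have := pellX_two_mul n
    omega
  rw [← Nat.add_mod_right (pellX (2 * n)) q, ← h]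
  exact (((Nat.mod_modEq _ _).pow 2).mul_left 2).add_right _

lemma iterate_doublingMap {q : ℕ} (hq : 0 < q) (d t : ℕ) :
    (doublingMap q)^[t] (pellX (2 * d) % q) = pellX (2 * (2 ^ t * d)) % q := by
  induction t with
  | zero => simp
  | succ t ih =>
    rw [Function.iterate_succ_apply', ih, doublingMap_pellX_mod hq]
    congr 2
    ring

/-- Both primes that occur are such that for every `t` one of the numbers `X (2 ^ (t + 1) * d)`
with `d` in `{3, 5, 15}` is a nonresidue; the values are periodic in `t`. -/
lemma exists_pellX_nonsquare {q : ℕ} [Fact q.Prime] (hq : q = 29 ∨ q = 2909) (t : ℕ) :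
    ∃ d ∈ [3, 5, 15], ¬ IsSquare (pellX (2 * (2 ^ t * d)) : ZMod q) := by
  have key : (∀ d ∈ [3, 5, 15], (doublingMap q)^[48] (pellX (2 * d) % q) = pellX (2 * d) % q) ∧
      ∀ t < 48, ∃ d ∈ [3, 5, 15],
        ((doublingMap q)^[t] (pellX (2 * d) % q)) ^ (q / 2) % q = q - 1 := by
    rcases hq with rfl | rfl <;> decide +kernel
  have hq₀ : 0 < q := (Fact.out : q.Prime).pos
  obtain ⟨d, hd, hpow⟩ := key.2 (t % 48) (Nat.mod_lt _ (by norm_num))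
  refine ⟨d, hd, fun hsq ↦ ?_⟩
  have hper : Function.IsPeriodicPt (doublingMap q) 48 (pellX (2 * d) % q) := key.1 d hd
  rw [hper.iterate_mod_apply, iterate_doublingMap hq₀, ← Nat.pow_mod] at hpow
  exact ZMod.pow_div_two_mod_ne_of_isSquare (by rcases hq with rfl | rfl <;> norm_num) hsq hpow

lemma false_of_sq_eq_of_mod_sixty {n j q : ℕ} [Fact q.Prime] {w : ℤ}
    (hw : w ^ 2 = 24 * pellX n - 39) (hq : q = 8 * pellX j + 13) (hq' : q = 29 ∨ q = 2909)
    (hj : j ≤ 5) {m : ℕ} (hn : n = 60 * m + j ∨ n + j = 60 * m) (hm : m ≠ 0) : False := by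
  obtain ⟨t, g, hg, rfl⟩ := Nat.exists_eq_two_pow_mul_odd hm
  obtain ⟨d, hd, hns⟩ := exists_pellX_nonsquare hq' t
  obtain ⟨e, he, hde⟩ : ∃ e, Odd e ∧ d * e = 15 := by
    simp only [List.mem_cons, List.not_mem_nil, or_false] at hd
    rcases hd with rfl | rfl | rfl
    exacts [⟨5, by decide, rfl⟩, ⟨3, by decide, rfl⟩, ⟨1, by decide, rfl⟩]
  have h60 : 60 * (2 ^ t * g) = 2 * (2 * (2 ^ t * d)) * (e * g) := by
    calc 60 * (2 ^ t * g) = 4 * 15 * (2 ^ t * g) := by ring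
      _ = _ := by rw [← hde]; ring
  have hjd : j ≤ 2 * (2 * (2 ^ t * d)) := by
    have h₁ : 3 ≤ d := by
      simp only [List.mem_cons, List.not_mem_nil, or_false] at hd
      omega
    have h₂ : d ≤ 2 ^ t * d := Nat.le_mul_of_pos_left d (by positivity)
    omega
  refine hns (isSquare_pellX hw hq (by rcases hq' with rfl | rfl <;> norm_num) ?_)
  rw [h60] at hn
  rcases hn with hn | hn
  · exact pellX_dvd_of_eq_add (he.mul hg) hn
  · exact pellX_dvd_of_add_eq (he.mul hg) hjd hn

lemma pellX_mod_period {p l : ℕ} (h₀ : pellX l % p = 1 % p) (h₁ : pellX (l + 1) % p = 2 % p)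
    (n : ℕ) : pellX (n % l) % p = pellX n % p := by
  have hper : ∀ n, (pellX (n + l) : ZMod p) = pellX n ∧
      (pellX (n + 1 + l) : ZMod p) = pellX (n + 1) := by
    intro n
    induction n with
    | zero =>
      refine ⟨(ZMod.natCast_eq_natCast_iff _ _ _).mpr ?_,
        (ZMod.natCast_eq_natCast_iff _ _ _).mpr ?_⟩
      · rw [zero_add]
        exact h₀
      · rw [zero_add, add_comm]
        exact h₁
    | succ n ih =>
      refine ⟨ih.2, ?_⟩
      have e₁ := congrArg (Nat.cast : ℕ → ZMod p) (xn_succ_succ (one_lt_two : 1 < 2) (n + l))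
      have e₂ := congrArg (Nat.cast : ℕ → ZMod p) (xn_succ_succ (one_lt_two : 1 < 2) n)
      rw [show n + l + 2 = n + 1 + 1 + l by ring, show n + l + 1 = n + 1 + l by ring] at e₁
      push_cast at e₁ e₂
      linear_combination e₁ - e₂ - ih.1 + 4 * ih.2
  have : Function.Periodic (fun n ↦ (pellX n : ZMod p)) l := fun n ↦ (hper n).1
  exact (ZMod.natCast_eq_natCast_iff' _ _ _).mp (this.map_mod_nat n)

lemma mod_sixty_of_sq_eq {n : ℕ} {w : ℤ} (hn : n % 2 = 1) (hw : w ^ 2 = 24 * pellX n - 39) :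
    n % 60 ∈ [1, 5, 55, 59] := by
  have sieve : ∀ r < 180, r % 2 = 1 → r % 60 ∈ [1, 5, 55, 59] ∨
      ∃ p ∈ [17, 37, 89, 241], (24 * pellX r + 39 * (p - 1)) ^ (p / 2) % p = p - 1 := by
    decide +kernel
  have period : ∀ p ∈ [17, 37, 89, 241],
      pellX 180 % p = 1 % p ∧ pellX (180 + 1) % p = 2 % p := by
    decide +kernel
  rcases sieve (n % 180) (Nat.mod_lt _ (by norm_num)) (by omega) with h | ⟨p, hp, h⟩
  · rwa [Nat.mod_mod_of_dvd n (by norm_num : 60 ∣ 180)] at h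
  · exfalso
    have hprime : p.Prime ∧ p ≠ 2 := by
      simp only [List.mem_cons, List.not_mem_nil, or_false] at hp
      rcases hp with rfl | rfl | rfl | rfl <;> norm_num
    have : Fact p.Prime := ⟨hprime.1⟩
    refine ZMod.pow_div_two_mod_ne_of_isSquare hprime.2 ⟨(w : ZMod p), ?_⟩ h
    have hX : (pellX (n % 180) : ZMod p) = pellX n := (ZMod.natCast_eq_natCast_iff' _ _ _).mpr
      (pellX_mod_period (period p hp).1 (period p hp).2 n)
    have hw' := congrArg (Int.cast : ℤ → ZMod p) hw
    push_cast [Nat.cast_sub hprime.1.one_le, hX] at hw' ⊢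
    simp only [CharP.cast_eq_zero]
    linear_combination -hw'

/-- The only odd `n` for which `(8 * X n - 13) / 3` can be a square are `1` and `5`. -/
lemma eq_one_or_five_of_sq_eq {n : ℕ} {w : ℤ} (hn : n % 2 = 1)
    (hw : w ^ 2 = 24 * pellX n - 39) : n = 1 ∨ n = 5 := by
  have : Fact (Nat.Prime 29) := ⟨by norm_num⟩
  have : Fact (Nat.Prime 2909) := ⟨by norm_num⟩
  have h₁ : 29 = 8 * pellX 1 + 13 := by decide +kernel
  have h₅ : 2909 = 8 * pellX 5 + 13 := by decide +kernel
  have hmod := mod_sixty_of_sq_eq hn hw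
  simp only [List.mem_cons, List.not_mem_nil, or_false] at hmod
  by_contra! hne
  rcases hmod with h | h | h | h
  · exact false_of_sq_eq_of_mod_sixty (m := n / 60) hw h₁ (.inl rfl) (by norm_num)
      (.inl (by omega)) (by omega)
  · exact false_of_sq_eq_of_mod_sixty (m := n / 60) hw h₅ (.inr rfl) (by norm_num)
      (.inl (by omega)) (by omega)
  · exact false_of_sq_eq_of_mod_sixty (m := n / 60 + 1) hw h₅ (.inr rfl) (by norm_num)
      (.inr (by omega)) (by omega)
  · exact false_of_sq_eq_of_mod_sixty (m := n / 60 + 1) hw h₁ (.inl rfl) (by norm_num)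
      (.inr (by omega)) (by omega)

lemma exists_pellX_eq {N a b : ℤ} (hN : 0 ≤ N) (ha : N + 1 = a ^ 2) (hb : 3 * N + 1 = b ^ 2) :
    ∃ n, (pellX n : ℤ) = 3 * N + 2 := by
  have hpell : (3 * N + 2).toNat * (3 * N + 2).toNat -
      3 * (a * b).natAbs * (a * b).natAbs = 1 := by
    suffices (3 * N + 2).toNat * (3 * N + 2).toNat =
        3 * (a * b).natAbs * (a * b).natAbs + 1 by omega
    zify
    rw [Int.toNat_of_nonneg (by omega), mul_assoc, abs_mul_abs_self]
    linear_combination 3 * (3 * N + 1) * ha + 3 * a ^ 2 * hb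
  obtain ⟨n, hn, -⟩ := eq_pell (one_lt_two : 1 < 2) hpell
  refine ⟨n, ?_⟩
  rw [pellX, ← hn, Int.toNat_of_nonneg (by omega)]

lemma even_of_sq_eq {N a b : ℤ} (ha : N + 1 = a ^ 2) (hb : 3 * N + 1 = b ^ 2) : N % 2 = 0 := by
  rcases Int.even_or_odd' a with ⟨k, rfl | rfl⟩ <;> rcases Int.even_or_odd' b with ⟨l, rfl | rfl⟩ <;>
    ring_nf at ha hb <;> omega

/-- **The Baker–Davenport theorem (1969).**
There is no integer `N > 120` such that `N + 1`, `3N + 1` and `8N + 1` are all perfect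
squares; equivalently, the set `{1, 3, 8, 120}` (in which the product of any two
distinct members increased by 1 is a perfect square) cannot be extended by any
`N > 120`. -/
theorem baker_davenport :
    ¬ ∃ N : ℤ, 120 < N ∧ (∃ a : ℤ, N + 1 = a ^ 2) ∧ (∃ b : ℤ, 3 * N + 1 = b ^ 2) ∧
      (∃ c : ℤ, 8 * N + 1 = c ^ 2) := by
  rintro ⟨N, hN, ⟨a, ha⟩, ⟨b, hb⟩, c, hc⟩
  obtain ⟨n, hn⟩ := exists_pellX_eq (by omega) ha hb
  have hodd : n % 2 = 1 := by
    by_contra h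
    have h₁ := pellX_two_mul_mod_two (n / 2)
    rw [show 2 * (n / 2) = n by omega] at h₁
    have h₂ := even_of_sq_eq ha hb
    omega
  have hw : (3 * c) ^ 2 = 24 * (pellX n : ℤ) - 39 := by
    rw [hn]
    linear_combination -9 * hc
  have h₁ : pellX 1 = 2 := by decide +kernel
  have h₅ : pellX 5 = 362 := by decide +kernel
  rcases eq_one_or_five_of_sq_eq hodd hw with rfl | rfl <;> omega
end

section
/- Let q ≥ 1 be an integer which is coprime to its Euler totient φ(q). Then the complex numbers L(1, χ) = ∑_{n=1}^{∞} χ(n)/n, as χ runs over all non-principal Dirichlet characters modulo q, are linearly independent over the rationals ℚ. -/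
theorem exists_differentiable_eq_pow_mul {f : ℂ → ℂ} (hf : Differentiable ℂ f) (a : ℂ) (k : ℕ)
    (hk : (k : ℕ∞) ≤ analyticOrderAt f a) :
    ∃ g : ℂ → ℂ, Differentiable ℂ g ∧ ∀ z, f z = (z - a) ^ k * g z := by
  induction k with
  | zero => exact ⟨f, hf, by simp⟩
  | succ k ih =>
    obtain ⟨g, hg, hfg⟩ := ih (le_trans (by norm_cast; omega) hk)
    have hga : g a = 0 := by
      by_contra hne
      have hlt : analyticOrderAt f a = k := by
        rw [(hf.analyticAt a).analyticOrderAt_eq_natCast]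
        exact ⟨g, hg.analyticAt a, hne, Filter.Eventually.of_forall fun z => by simpa using hfg z⟩
      rw [hlt] at hk
      norm_cast at hk
      omega
    refine ⟨dslope g a, ?_, fun z => ?_⟩
    · rw [← differentiableOn_univ, Complex.differentiableOn_dslope Filter.univ_mem]
      exact hg.differentiableOn
    · have := sub_smul_dslope g a z
      rw [hga, sub_zero, smul_eq_mul] at this
      rw [hfg, pow_succ, mul_assoc, this]

theorem exists_differentiable_eq_prod_pow_mul {f : ℂ → ℂ} (hf : Differentiable ℂ f)
    (Z : Finset ℂ) (k : ℕ) (hk : ∀ a ∈ Z, (k : ℕ∞) ≤ analyticOrderAt f a) :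
    ∃ g : ℂ → ℂ, Differentiable ℂ g ∧ ∀ z, f z = (∏ a ∈ Z, (z - a) ^ k) * g z := by
  classical
  induction Z using Finset.induction_on with
  | empty => exact ⟨f, hf, by simp⟩
  | insert a Z haZ ih =>
    obtain ⟨g, hg, hfg⟩ := ih fun b hb => hk b (Finset.mem_insert_of_mem hb)
    have hp : Differentiable ℂ fun z : ℂ => ∏ b ∈ Z, (z - b) ^ k := by fun_prop
    have hp0 : analyticOrderAt (fun z : ℂ => ∏ b ∈ Z, (z - b) ^ k) a = 0 := by
      rw [(hp.analyticAt a).analyticOrderAt_eq_zero]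
      exact Finset.prod_ne_zero_iff.2 fun b hb =>
        pow_ne_zero _ (sub_ne_zero.2 fun h => haZ (h ▸ hb))
    have hord : (k : ℕ∞) ≤ analyticOrderAt g a := by
      have h := hk a (Finset.mem_insert_self _ _)
      rwa [show f = (fun z : ℂ => ∏ b ∈ Z, (z - b) ^ k) * g from funext hfg,
        analyticOrderAt_mul (hp.analyticAt a) (hg.analyticAt a), hp0, zero_add] at h
    obtain ⟨h, hh, hgh⟩ := exists_differentiable_eq_pow_mul hg a k hord
    refine ⟨h, hh, fun z => ?_⟩
    rw [hfg, hgh, Finset.prod_insert haZ]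
    ring

/-- A Schwarz lemma for an entire function with many zeros at `0, 1, …, S - 1`. -/
theorem norm_iteratedDeriv_le_of_zeros {f : ℂ → ℂ} (hf : Differentiable ℂ f) {S k : ℕ} {R B : ℝ}
    (hz : ∀ i < S, ∀ m < k, iteratedDeriv m f (i : ℂ) = 0) (hR : 2 * (S : ℝ) ≤ R) (hR0 : 0 < R)
    (hB : ∀ z, ‖z‖ = R → ‖f z‖ ≤ B) {s : ℕ} (hs : s < S) :
    ‖iteratedDeriv k f (s : ℂ)‖ ≤ k.factorial * (B * (4 * S / R) ^ (S * k)) := by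
  classical
  obtain ⟨g, hg, hfg⟩ := exists_differentiable_eq_prod_pow_mul hf
    ((Finset.range S).image (fun i : ℕ => (i : ℂ))) k (by
      intro a ha
      obtain ⟨i, hi, rfl⟩ := Finset.mem_image.1 ha
      rw [natCast_le_analyticOrderAt_iff_iteratedDeriv_eq_zero (hf.analyticAt _)]
      exact hz i (Finset.mem_range.1 hi))
  have hS1 : 1 ≤ (S : ℝ) := by exact_mod_cast (by omega : 1 ≤ S)
  have hprod (z : ℂ) : ‖∏ a ∈ (Finset.range S).image (fun i : ℕ => (i : ℂ)), (z - a) ^ k‖ =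
      ∏ i ∈ Finset.range S, ‖z - (i : ℂ)‖ ^ k := by
    rw [Finset.prod_image (fun _ _ _ _ h => Nat.cast_injective h)]
    simp
  have hnat (i : ℕ) (hi : i ∈ Finset.range S) : ‖(i : ℂ)‖ ≤ S := by
    rw [Complex.norm_natCast]
    exact_mod_cast (Finset.mem_range.1 hi).le
  have hgR (z : ℂ) (hzR : ‖z‖ = R) : ‖g z‖ ≤ B / (R / 2) ^ (S * k) := by
    rw [le_div_iff₀ (by positivity)]
    calc ‖g z‖ * (R / 2) ^ (S * k)
        = ‖g z‖ * ∏ i ∈ Finset.range S, (R / 2) ^ k := by simp [← pow_mul, mul_comm]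
      _ ≤ ‖g z‖ * ∏ i ∈ Finset.range S, ‖z - (i : ℂ)‖ ^ k := by
          gcongr with i hi
          have h1 := norm_sub_norm_le z (i : ℂ)
          have h2 := hnat i hi
          linarith
      _ = ‖f z‖ := by rw [hfg, norm_mul, hprod, mul_comm]
      _ ≤ B := hB z hzR
  have hgin (z : ℂ) (hzS : ‖z‖ ≤ S) : ‖g z‖ ≤ B / (R / 2) ^ (S * k) := by
    refine Complex.norm_le_of_forall_mem_frontier_norm_le (U := Metric.ball 0 R)
      Metric.isBounded_ball hg.diffContOnCl (fun w hw => hgR w ?_) ?_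
    · rw [frontier_ball _ hR0.ne'] at hw
      simpa using hw
    · refine subset_closure ?_
      rw [mem_ball_zero_iff]
      linarith
  have hfin (z : ℂ) (hzS : ‖z‖ ≤ S) : ‖f z‖ ≤ B * (4 * S / R) ^ (S * k) := by
    calc ‖f z‖ = (∏ i ∈ Finset.range S, ‖z - (i : ℂ)‖ ^ k) * ‖g z‖ := by
          rw [hfg, norm_mul, hprod]
      _ ≤ (∏ i ∈ Finset.range S, (2 * (S : ℝ)) ^ k) * (B / (R / 2) ^ (S * k)) := by
          gcongr with i hi
          · have h1 := norm_sub_le z (i : ℂ)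
            have h2 := hnat i hi
            linarith
          · exact hgin z hzS
      _ = B * (4 * S / R) ^ (S * k) := by
          rw [Finset.prod_const, Finset.card_range, ← pow_mul, mul_comm k S,
            show (4 * S / R : ℝ) = 2 * S / (R / 2) by field_simp; norm_num, div_pow _ (R / 2)]
          ring
  have hs' : (s : ℝ) + 1 ≤ S := by exact_mod_cast hs
  have := Complex.norm_iteratedDeriv_le_of_forall_mem_sphere_norm_le (c := (s : ℂ)) k one_pos
    hf.diffContOnCl (fun z hzs => hfin z (by
      rw [mem_sphere_iff_norm] at hzs
      calc ‖z‖ = ‖(z - s) + s‖ := by simp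
        _ ≤ ‖z - s‖ + ‖(s : ℂ)‖ := norm_add_le _ _
        _ ≤ S := by rw [hzs, Complex.norm_natCast]; linarith))
  simpa using this

theorem iteratedDeriv_sum_mul_cexp {C : Type*} [Fintype C] (w u : C → ℂ) (m : ℕ) :
    iteratedDeriv m (fun t => ∑ c, w c * Complex.exp (u c * t)) =
      fun t => ∑ c, w c * u c ^ m * Complex.exp (u c * t) := by
  induction m with
  | zero => simp
  | succ m ih =>
    rw [iteratedDeriv_succ, ih]
    funext t
    refine HasDerivAt.deriv (HasDerivAt.fun_sum fun c _ => ?_)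
    have := (((hasDerivAt_id t).const_mul (u c)).cexp).const_mul (w c * u c ^ m)
    convert! this using 1
    simp only [id_eq]
    ring

/-- Schwarz lemma for exponential sums vanishing to order `k` at `0, 1, …, S - 1`. -/
theorem norm_sum_mul_pow_mul_cexp_le {C : Type*} [Fintype C] (w u : C → ℂ) {S k : ℕ} {R U : ℝ}
    (hz : ∀ i < S, ∀ m < k, ∑ c, w c * u c ^ m * Complex.exp (u c * (i : ℕ)) = 0)
    (hu : ∀ c, ‖u c‖ ≤ U) (hR : 2 * (S : ℝ) ≤ R) (hR0 : 0 < R) {s : ℕ} (hs : s < S) :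
    ‖∑ c, w c * u c ^ k * Complex.exp (u c * s)‖ ≤
      k.factorial * ((∑ c, ‖w c‖) * Real.exp (U * R) * (4 * S / R) ^ (S * k)) := by
  have hd := iteratedDeriv_sum_mul_cexp w u
  have := norm_iteratedDeriv_le_of_zeros (f := fun t => ∑ c, w c * Complex.exp (u c * t))
    (by fun_prop) (S := S) (k := k) (R := R) (B := (∑ c, ‖w c‖) * Real.exp (U * R))
    (fun i hi m hm => by rw [hd]; exact hz i hi m hm) hR hR0 (fun z hzR => by
      rw [Finset.sum_mul]
      refine (norm_sum_le _ _).trans (Finset.sum_le_sum fun c _ => ?_)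
      rw [norm_mul, Complex.norm_exp]
      gcongr
      calc (u c * z).re ≤ ‖u c * z‖ := Complex.re_le_norm _
        _ ≤ U * R := by rw [norm_mul, hzR]; gcongr; exact hu c) hs
  rwa [hd] at this

/-- Replacing linear forms by their expressions in other linear forms inside monomials. -/
theorem norm_sum_mul_prod_pow_le {C J J' : Type*} [Fintype C] [Fintype J] [Fintype J']
    (w : C → ℂ) (P : C → J' → ℂ) (Q : C → J → ℂ) (A : J → J' → ℂ) {a M : ℝ}
    (hQ : ∀ c j, Q c j = ∑ j', A j j' * P c j') (hA : ∀ j j', ‖A j j'‖ ≤ a) (k : J → ℕ)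
    (hM : ∀ k' : J' → ℕ, ∑ j, k' j = ∑ j, k j → ‖∑ c, w c * ∏ j, P c j ^ k' j‖ ≤ M) :
    ‖∑ c, w c * ∏ j, Q c j ^ k j‖ ≤ (Fintype.card J' * a) ^ (∑ j, k j) * M := by
  classical
  suffices H : ∀ (m : ℕ) (k : J → ℕ) (k' : J' → ℕ), ∑ j, k j = m →
      (∀ l : J' → ℕ, ∑ j, l j = ∑ j, k' j + m → ‖∑ c, w c * ∏ j, P c j ^ l j‖ ≤ M) →
      ‖∑ c, w c * ((∏ j, P c j ^ k' j) * ∏ j, Q c j ^ k j)‖ ≤ (Fintype.card J' * a) ^ m * M by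
    simpa using H _ k 0 rfl (fun l hl => hM l (by simpa using hl))
  intro m
  induction m with
  | zero =>
    intro k k' hk h
    have hk0 : ∀ j, k j = 0 := by simpa using hk
    simpa [hk0] using h k' (by simp)
  | succ m ih =>
    intro k k' hk h
    obtain ⟨j₀, hj₀⟩ : ∃ j, k j ≠ 0 := by
      by_contra! h0
      simp [h0] at hk
    obtain ⟨k₁, rfl⟩ : ∃ k₁ : J → ℕ, k = k₁ + Pi.single j₀ 1 :=
      ⟨k - Pi.single j₀ 1, (tsub_add_cancel_of_le (by
        intro j
        rcases eq_or_ne j j₀ with rfl | hj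
        · simpa using Nat.one_le_iff_ne_zero.2 hj₀
        · simp [hj])).symm⟩
    have hkm : ∑ j, k₁ j = m := by
      simpa [Finset.sum_add_distrib] using hk
    have hexp (c : C) : w c * ((∏ j, P c j ^ k' j) * ∏ j, Q c j ^ (k₁ + Pi.single j₀ 1 : J → ℕ) j) =
        ∑ i, A j₀ i * (w c * ((∏ j, P c j ^ (k' + Pi.single i 1 : J' → ℕ) j) *
          ∏ j, Q c j ^ k₁ j)) := by
      have h1 : ∏ j, Q c j ^ (k₁ + Pi.single j₀ 1 : J → ℕ) j = (∏ j, Q c j ^ k₁ j) * Q c j₀ := by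
        simp_rw [Pi.add_apply, pow_add, Finset.prod_mul_distrib]
        simp [Pi.single_apply, Finset.prod_ite_eq', pow_ite]
      have h2 (i : J') : ∏ j, P c j ^ (k' + Pi.single i 1 : J' → ℕ) j = (∏ j, P c j ^ k' j) * P c i := by
        simp_rw [Pi.add_apply, pow_add, Finset.prod_mul_distrib]
        simp [Pi.single_apply, Finset.prod_ite_eq', pow_ite]
      simp_rw [h1, h2, hQ c j₀, Finset.mul_sum]
      exact Finset.sum_congr rfl fun i _ => by ring
    simp_rw [hexp]
    rw [Finset.sum_comm]
    simp_rw [← Finset.mul_sum]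
    have hterm (i : J') := ih k₁ (k' + Pi.single i 1) hkm (fun l hl => h l (by
      rw [hl]
      simp only [Pi.add_apply, Finset.sum_add_distrib, Finset.sum_pi_single', Finset.mem_univ,
        if_true]
      ring))
    refine (norm_sum_le _ _).trans ?_
    calc ∑ i, ‖A j₀ i * _‖ ≤ ∑ i : J', a * ((Fintype.card J' * a) ^ m * M) := by
          refine Finset.sum_le_sum fun i _ => ?_
          rw [norm_mul]
          exact mul_le_mul (hA _ _) (hterm i) (norm_nonneg _) ((norm_nonneg _).trans (hA j₀ i))
      _ = _ := by
          rw [Finset.sum_const, Finset.card_univ, nsmul_eq_mul]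
          ring

section NumberField

open NumberField

theorem NumberField.one_le_norm_mul_house_pow {L : Type*} [Field L] [NumberField L]
    (τ : L →+* ℂ) {x : 𝓞 L} (hx : x ≠ 0) :
    1 ≤ ‖τ x‖ * house (x : L) ^ (Module.finrank ℚ L - 1) := by
  refine le_trans ?_ (norm_norm_le_norm_mul_house_pow (x : L) τ)
  rw [← Algebra.coe_norm_int, ← Rat.norm_cast_real, Rat.cast_intCast, Real.norm_eq_abs]
  exact_mod_cast Int.one_le_abs (Algebra.norm_ne_zero_iff.2 hx)

theorem NumberField.exists_siegel_const (L : Type*) [Field L] [NumberField L] :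
    ∃ C : ℝ, 1 ≤ C ∧ ∀ (α β : Type) [Fintype α] [Fintype β] (a : Matrix α β (𝓞 L)) (A : ℝ),
      a ≠ 0 → 0 < Fintype.card α → 2 * Fintype.card α ≤ Fintype.card β → 1 ≤ A →
      (∀ k l, house (a k l : L) ≤ A) →
      ∃ ξ : β → 𝓞 L, ξ ≠ 0 ∧ Matrix.mulVec a ξ = 0 ∧
        ∀ l, house (ξ l : L) ≤ C * (C * Fintype.card β * A) := by
  classical
  have key : ∃ c : ℝ, ∀ (α β : Type) [Fintype α] [Fintype β] (a : Matrix α β (𝓞 L)) (A : ℝ),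
      a ≠ 0 → 0 < Fintype.card α → 2 * Fintype.card α ≤ Fintype.card β →
      (∀ k l, house (a k l : L) ≤ A) →
      ∃ ξ : β → 𝓞 L, ξ ≠ 0 ∧ Matrix.mulVec a ξ = 0 ∧
        ∀ l, house (ξ l : L) ≤ c * (c * Fintype.card β * A) ^ 
          ((Fintype.card α : ℝ) / (Fintype.card β - Fintype.card α)) :=
    ⟨_, fun α β _ _ a A ha h0 hαβ hA => house.exists_ne_zero_int_vec_house_le L a ha h0
      (by omega) rfl hA rfl⟩
  obtain ⟨c, hc⟩ := key
  refine ⟨max 1 |c|, le_max_left _ _, fun α β _ _ a A ha h0 hαβ hA1 hA => ?_⟩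
  obtain ⟨ξ, hξ, hξ0, hle⟩ := hc α β a A ha h0 hαβ hA
  refine ⟨ξ, hξ, hξ0, fun l => (hle l).trans ?_⟩
  have hβ : (1 : ℝ) ≤ Fintype.card β := by exact_mod_cast (by omega)
  have hα : (0 : ℝ) < Fintype.card α := by exact_mod_cast h0
  have hαβ' : 2 * (Fintype.card α : ℝ) ≤ Fintype.card β := by exact_mod_cast hαβ
  set C := max 1 |c|
  have hC1 : 1 ≤ C := le_max_left _ _
  have hcC : |c| ≤ C := le_max_right _ _
  have hbase : 1 ≤ C * Fintype.card β * A :=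
    one_le_mul_of_one_le_of_one_le (one_le_mul_of_one_le_of_one_le hC1 hβ) hA1
  set e : ℝ := (Fintype.card α : ℝ) / (Fintype.card β - Fintype.card α)
  have he0 : 0 ≤ e := div_nonneg hα.le (by linarith)
  have he1 : e ≤ 1 := by
    rw [div_le_one (by linarith)]
    linarith
  calc c * (c * Fintype.card β * A) ^ e
      ≤ |c * (c * Fintype.card β * A) ^ e| := le_abs_self _
    _ ≤ |c| * |c * Fintype.card β * A| ^ e := by
        rw [abs_mul]
        gcongr
        exact Real.abs_rpow_le_abs_rpow _ _
    _ ≤ C * (C * Fintype.card β * A) ^ e := by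
        rw [abs_mul, abs_mul, Nat.abs_cast, abs_of_nonneg (zero_le_one.trans hA1)]
        gcongr
    _ ≤ C * (C * Fintype.card β * A) ^ (1 : ℝ) := by gcongr
    _ = C * (C * Fintype.card β * A) := by rw [Real.rpow_one]

/-- Upper bound for a derivative of lowest nonvanishing order of an exponential polynomial in
several variables with many zeros on a grid. -/
theorem norm_sum_mul_prod_pow_mul_cexp_le {C J : Type*} [Fintype C] [Fintype J] [Nonempty J]
    (w : C → ℂ) (X Y : C → J → ℂ) (A B : J → J → ℂ) {a U R : ℝ} {S T E : ℕ}
    (hY : ∀ c j, Y c j = ∑ j', A j j' * X c j') (hX : ∀ c j, X c j = ∑ j', B j j' * Y c j')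
    (hA : ∀ j j', ‖A j j'‖ ≤ a) (hB : ∀ j j', ‖B j j'‖ ≤ a)
    (hU : ∀ c j, ‖Y c j‖ ≤ U) (hU1 : 1 ≤ U) (hR : 4 * (S : ℝ) ≤ R) (hR0 : 0 < R)
    (hE : ∀ r : ℕ, T ≤ Fintype.card J * r → E ≤ S * r)
    (hvan : ∀ k s : J → ℕ, ∑ j, k j < T → (∀ j, s j < S) →
      ∑ c, w c * Complex.exp (∑ j, Y c j * s j) * ∏ j, X c j ^ k j = 0)
    (k s : J → ℕ) (hk : ∑ j, k j = T) (hs : ∀ j, s j < S) :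
    ‖∑ c, w c * Complex.exp (∑ j, Y c j * s j) * ∏ j, X c j ^ k j‖ ≤
      (Fintype.card J * a) ^ T * ((T : ℝ) ^ T * ((∑ c, ‖w c‖) * U ^ T *
        Real.exp (U * (Fintype.card J * S)) * Real.exp (U * R) * (4 * S / R) ^ E)) := by
  classical
  have hvanY (k s : J → ℕ) (hk : ∑ j, k j < T) (hs : ∀ j, s j < S) :
      ∑ c, w c * Complex.exp (∑ j, Y c j * s j) * ∏ j, Y c j ^ k j = 0 := by
    have := norm_sum_mul_prod_pow_le (fun c => w c * Complex.exp (∑ j, Y c j * s j)) X Y A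
      (M := 0) hY hA k (fun k' hk' => by rw [hvan k' s (hk' ▸ hk) hs, norm_zero])
    rw [mul_zero] at this
    exact norm_le_zero_iff.1 this
  subst hk
  refine norm_sum_mul_prod_pow_le (fun c => w c * Complex.exp (∑ j, Y c j * s j)) Y X B hX hB k
    (fun k hk => ?_)
  rw [← hk] at hvanY hE ⊢
  clear hk hvan
  obtain ⟨j₀, hj₀⟩ : ∃ j, ∑ i, k i ≤ Fintype.card J * k j := by
    obtain ⟨j, -, hj⟩ := Finset.exists_max_image Finset.univ k Finset.univ_nonempty
    exact ⟨j, by simpa using Finset.sum_le_card_nsmul Finset.univ k (k j) hj⟩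
  set w' : C → ℂ := fun c => w c * Complex.exp (∑ j ∈ Finset.univ.erase j₀, Y c j * s j) *
    ∏ j ∈ Finset.univ.erase j₀, Y c j ^ k j with hw'
  have hsplit (c : C) (m i : ℕ) : w' c * Y c j₀ ^ m * Complex.exp (Y c j₀ * i) =
      w c * Complex.exp (∑ j, Y c j * (Function.update s j₀ i j : ℕ)) *
        ∏ j, Y c j ^ Function.update k j₀ m j := by
    rw [← Finset.mul_prod_erase _ _ (Finset.mem_univ j₀),
      ← Finset.add_sum_erase _ _ (Finset.mem_univ j₀), Complex.exp_add,
      Finset.prod_congr rfl fun j hj => by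
        rw [Function.update_of_ne (Finset.ne_of_mem_erase hj)],
      Finset.sum_congr (g := fun j => Y c j * (s j : ℂ)) rfl fun j hj => by
        rw [Function.update_of_ne (Finset.ne_of_mem_erase hj)]]
    simp only [Function.update_self, hw']
    ring
  have hmain := norm_sum_mul_pow_mul_cexp_le w' (fun c => Y c j₀) (S := S) (k := k j₀) (R := R)
    (U := U) (fun i hi m hm => by
      simp_rw [hsplit]
      refine hvanY _ _ ?_ ?_
      · refine Finset.sum_lt_sum (fun j _ => ?_) ⟨j₀, Finset.mem_univ _, by simpa using hm⟩
        rcases eq_or_ne j j₀ with rfl | hj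
        · simpa using hm.le
        · simp [hj]
      · intro j
        rcases eq_or_ne j j₀ with rfl | hj
        · simpa using hi
        · simpa [hj] using hs j) (fun c => hU c j₀) (by linarith [Nat.cast_nonneg (α := ℝ) S])
    hR0 (hs j₀)
  simp_rw [hsplit, Function.update_eq_self] at hmain
  refine hmain.trans ?_
  have hw'le (c : C) : ‖w' c‖ ≤ ‖w c‖ * (Real.exp (U * (Fintype.card J * S)) * U ^ ∑ j, k j) := by
    rw [hw', norm_mul, norm_mul, Complex.norm_exp, mul_assoc]
    gcongr
    · calc _ ≤ ‖∑ j ∈ Finset.univ.erase j₀, Y c j * s j‖ := Complex.re_le_norm _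
        _ ≤ ∑ j ∈ Finset.univ.erase j₀, U * S := by
          refine (norm_sum_le _ _).trans (Finset.sum_le_sum fun j _ => ?_)
          rw [norm_mul, Complex.norm_natCast]
          have := (hs j).le
          gcongr
          exact hU c j
        _ ≤ ∑ j : J, U * S := Finset.sum_le_sum_of_subset_of_nonneg (Finset.erase_subset _ _)
          fun _ _ _ => by positivity
        _ = _ := by simp; ring
    · rw [norm_prod, ← Finset.prod_pow_eq_pow_sum]
      calc _ ≤ ∏ j ∈ Finset.univ.erase j₀, U ^ k j := by
            refine Finset.prod_le_prod (fun _ _ => norm_nonneg _) fun j _ => ?_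
            rw [norm_pow]
            gcongr
            exact hU c j
        _ ≤ U ^ k j₀ * ∏ j ∈ Finset.univ.erase j₀, U ^ k j :=
            le_mul_of_one_le_left (by positivity) (one_le_pow₀ hU1)
        _ = _ := Finset.mul_prod_erase _ (fun j => U ^ k j) (Finset.mem_univ j₀)
  have hkT : k j₀ ≤ ∑ j, k j := Finset.single_le_sum (fun _ _ => Nat.zero_le _) (Finset.mem_univ j₀)
  have hfac : ((k j₀).factorial : ℝ) ≤ ((∑ j, k j : ℕ) : ℝ) ^ ∑ j, k j := by
    exact_mod_cast (Nat.factorial_le hkT).trans (Nat.factorial_le_pow _)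
  have hq : (4 * S / R : ℝ) ^ (S * k j₀) ≤ (4 * S / R) ^ E :=
    pow_le_pow_of_le_one (by positivity) ((div_le_one hR0).2 hR) (hE _ hj₀)
  have hsum : ∑ c, ‖w' c‖ ≤ (∑ c, ‖w c‖) * U ^ (∑ j, k j) *
      Real.exp (U * (Fintype.card J * S)) := by
    calc _ ≤ _ := Finset.sum_le_sum fun c _ => hw'le c
      _ = _ := by rw [← Finset.sum_mul]; ring
  gcongr

namespace LinearForms

variable {R I J : Type*} [CommRing R] [Fintype I]

/-- The `ℕ`-linear combination of the rows of `x` with coefficients `c`. -/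
def rowComb (x : I → J → R) (c : I → ℕ) (j : J) : R := ∑ i, c i * x i j

theorem map_rowComb {R' : Type*} [CommRing R'] (f : R →+* R') (x : I → J → R) (c : I → ℕ)
    (j : J) : f (rowComb x c j) = rowComb (fun i j => f (x i j)) c j := by
  simp [rowComb]

theorem norm_rowComb_le (x : I → J → ℂ) {B : ℝ} (j : J) (hx : ∑ i, ‖x i j‖ ≤ B) {c : I → ℕ} {N : ℕ}
    (hc : ∀ i, c i ≤ N) : ‖rowComb x c j‖ ≤ B * N := by
  calc ‖rowComb x c j‖ ≤ ∑ i, ‖x i j‖ * N := by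
        refine (norm_sum_le _ _).trans (Finset.sum_le_sum fun i _ => ?_)
        rw [norm_mul, Complex.norm_natCast, mul_comm]
        gcongr
        exact hc i
    _ ≤ B * N := by
        rw [← Finset.sum_mul]
        gcongr

variable [Fintype J]

/-- The monomial `∏ W i j ^ (c i * s j)`, homogenized to degree `M` by means of `b`. -/
def homMonomial (b : ℕ) (W : I → J → R) (M : ℕ) (c : I → ℕ) (s : J → ℕ) : R :=
  (b : R) ^ (M - ∑ i, ∑ j, c i * s j) * ∏ i, ∏ j, W i j ^ (c i * s j)

theorem map_homMonomial {R' : Type*} [CommRing R'] (f : R →+* R') (b : ℕ) (W : I → J → R) (M : ℕ)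
    (c : I → ℕ) (s : J → ℕ) :
    f (homMonomial b W M c s) = homMonomial b (fun i j => f (W i j)) M c s := by
  simp [homMonomial]

theorem norm_homMonomial_le {b : ℕ} {W : I → J → ℂ} {B : ℝ} (hb : (b : ℝ) ≤ B)
    (hW : ∀ i j, ‖W i j‖ ≤ B) {M : ℕ} {c : I → ℕ} {s : J → ℕ} (hM : ∑ i, ∑ j, c i * s j ≤ M) :
    ‖homMonomial b W M c s‖ ≤ B ^ M := by
  have hB : 0 ≤ B := (Nat.cast_nonneg b).trans hb
  calc ‖homMonomial b W M c s‖
      ≤ B ^ (M - ∑ i, ∑ j, c i * s j) * ∏ i, ∏ j, B ^ (c i * s j) := by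
        simp only [homMonomial, norm_mul, norm_pow, norm_prod, Complex.norm_natCast]
        gcongr
        exact hW _ _
    _ = B ^ M := by
        simp_rw [Finset.prod_pow_eq_pow_sum]
        rw [← pow_add, Nat.sub_add_cancel hM]

theorem homMonomial_eq_cexp {b : ℕ} {W y : I → J → ℂ} (hW : ∀ i j, W i j = b * Complex.exp (y i j))
    {M : ℕ} {c : I → ℕ} {s : J → ℕ} (hM : ∑ i, ∑ j, c i * s j ≤ M) :
    homMonomial b W M c s = b ^ M * Complex.exp (∑ j, rowComb y c j * s j) := by
  have h1 : ∑ j, rowComb y c j * s j = ∑ i, ∑ j, ((c i * s j : ℕ) : ℂ) * y i j := by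
    simp_rw [rowComb, Finset.sum_mul]
    rw [Finset.sum_comm]
    refine Finset.sum_congr rfl fun i _ => Finset.sum_congr rfl fun j _ => ?_
    push_cast
    ring
  rw [h1, Complex.exp_sum]
  simp_rw [Complex.exp_sum, Complex.exp_nat_mul, homMonomial, hW, mul_pow,
    Finset.prod_mul_distrib, Finset.prod_pow_eq_pow_sum]
  rw [← mul_assoc, ← pow_add, Nat.sub_add_cancel hM]

/-- The exponents `c` range over a box of side `N`, the points `s` over a box of side `S`. -/
theorem sum_sum_mul_le {c : I → ℕ} {s : J → ℕ} {N S : ℕ} (hc : ∀ i, c i ≤ N) (hs : ∀ j, s j ≤ S) :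
    ∑ i, ∑ j, c i * s j ≤ Fintype.card I * (Fintype.card J * (N * S)) := by
  calc ∑ i, ∑ j, c i * s j ≤ ∑ _i : I, ∑ _j : J, N * S := by
        gcongr with i _ j _
        · exact hc i
        · exact hs j
    _ = _ := by simp

theorem norm_prod_rowComb_pow_le {x : I → J → ℂ} {B : ℝ} (hx : ∀ j, ∑ i, ‖x i j‖ ≤ B)
    {c : I → ℕ} {N : ℕ} (hc : ∀ i, c i ≤ N) (k : J → ℕ) :
    ‖∏ j, rowComb x c j ^ k j‖ ≤ (B * N) ^ ∑ j, k j := by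
  rw [norm_prod, ← Finset.prod_pow_eq_pow_sum]
  refine Finset.prod_le_prod (fun _ _ => norm_nonneg _) fun j _ => ?_
  rw [norm_pow]
  gcongr
  exact norm_rowComb_le x j (hx j) hc

variable [DecidableEq I]

/-- The value at the point `s` of the derivative of order `k` of the auxiliary function with
coefficients `p`. -/
def auxValue {N : ℕ} (b : ℕ) (x W : I → J → R) (M : ℕ) (p : (I → Fin N) → R) (k s : J → ℕ) : R :=
  ∑ c, p c * homMonomial b W M (fun i => c i) s * ∏ j, rowComb x (fun i => c i) j ^ k j

theorem map_auxValue {R' : Type*} [CommRing R'] (f : R →+* R') {N : ℕ} (b : ℕ) (x W : I → J → R)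
    (M : ℕ) (p : (I → Fin N) → R) (k s : J → ℕ) :
    f (auxValue b x W M p k s) =
      auxValue b (fun i j => f (x i j)) (fun i j => f (W i j)) M (fun c => f (p c)) k s := by
  simp [auxValue, map_rowComb, map_homMonomial]

theorem norm_auxValue_le {N b : ℕ} {x W : I → J → ℂ} {B P : ℝ} (hb : (b : ℝ) ≤ B)
    (hx : ∀ j, ∑ i, ‖x i j‖ ≤ B) (hW : ∀ i j, ‖W i j‖ ≤ B) {p : (I → Fin N) → ℂ}
    (hp : ∀ c, ‖p c‖ ≤ P) {S : ℕ} (k s : J → ℕ) (hs : ∀ j, s j ≤ S) :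
    ‖auxValue b x W (Fintype.card I * (Fintype.card J * (N * S))) p k s‖ ≤
      N ^ Fintype.card I * (P * B ^ (Fintype.card I * (Fintype.card J * (N * S))) *
        (B * N) ^ ∑ j, k j) := by
  have hB : 0 ≤ B := (Nat.cast_nonneg b).trans hb
  calc _ ≤ ∑ _c : I → Fin N, P * B ^ (Fintype.card I * (Fintype.card J * (N * S))) *
        (B * N) ^ ∑ j, k j := by
        refine (norm_sum_le _ _).trans (Finset.sum_le_sum fun c _ => ?_)
        have hP : 0 ≤ P := (norm_nonneg _).trans (hp c)
        have hc (i : I) : (c i : ℕ) ≤ N := (c i).is_lt.le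
        rw [norm_mul, norm_mul]
        gcongr
        · exact hp c
        · exact norm_homMonomial_le hb hW (sum_sum_mul_le hc hs)
        · exact norm_prod_rowComb_pow_le hx hc k
    _ = _ := by simp

theorem auxValue_eq_cexp {N b : ℕ} {x W y : I → J → ℂ}
    (hW : ∀ i j, W i j = b * Complex.exp (y i j)) {p : (I → Fin N) → ℂ} {S : ℕ} (k s : J → ℕ)
    (hs : ∀ j, s j ≤ S) :
    auxValue b x W (Fintype.card I * (Fintype.card J * (N * S))) p k s =
      b ^ (Fintype.card I * (Fintype.card J * (N * S))) *
        ∑ c, p c * Complex.exp (∑ j, rowComb y (fun i => c i) j * s j) *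
          ∏ j, rowComb x (fun i => c i) j ^ k j := by
  rw [auxValue, Finset.mul_sum]
  refine Finset.sum_congr rfl fun c _ => ?_
  rw [homMonomial_eq_cexp hW (sum_sum_mul_le (fun i => (c i).is_lt.le) hs)]
  ring

/-- The auxiliary function does not vanish to infinite order at the origin. -/
theorem exists_auxValue_ne_zero [IsDomain R] [CharZero R] {N b : ℕ} (hb : b ≠ 0)
    (x W : I → J → R) (M : ℕ) (j₀ : J)
    (hinj : Function.Injective fun c : I → ℕ => rowComb x c j₀)
    {p : (I → Fin N) → R} (hp : p ≠ 0) : ∃ k, auxValue b x W M p k 0 ≠ 0 := by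
  classical
  by_contra! h
  apply hp
  have hlin := linearIndependent_monoidHom (Multiplicative ℕ) R
  have hcomp := hlin.comp (fun c : I → Fin N => powersHom R (rowComb x (fun i => c i) j₀)) (by
    intro c c' hcc
    have := hinj ((powersHom R).injective hcc)
    funext i
    exact Fin.ext (congrFun this i))
  rw [Fintype.linearIndependent_iff] at hcomp
  funext c
  refine hcomp p ?_ c
  funext m
  have hm := h (Pi.single j₀ m.toAdd)
  have hb' : (b : R) ^ M ≠ 0 := pow_ne_zero _ (Nat.cast_ne_zero.2 hb)
  refine (mul_eq_zero.1 (Eq.trans ?_ hm)).resolve_left hb'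
  simp only [auxValue, homMonomial, Pi.zero_apply, mul_zero, Finset.sum_const_zero, tsub_zero,
    pow_zero, Finset.prod_const_one, mul_one, Finset.sum_apply, Pi.smul_apply, Finset.mul_sum,
    Function.comp, smul_eq_mul, powersHom_apply]
  refine Finset.sum_congr rfl fun c _ => ?_
  rw [Finset.prod_eq_single j₀ (by intro j _ hj; simp [hj]) (by simp)]
  simp
  ring

end LinearForms

namespace LinearForms

theorem exists_pow_le_lt_succ_pow (n T : ℕ) :
    ∃ m, m ^ (n + 1) ≤ T ∧ T < (m + 1) ^ (n + 1) := by
  have hlt : ∃ m, T < (m + 1) ^ (n + 1) :=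
    ⟨T, (Nat.lt_succ_self T).trans_le (Nat.le_self_pow (by omega) _)⟩
  classical
  refine ⟨Nat.find hlt, ?_, Nat.find_spec hlt⟩
  rcases h : Nat.find hlt with _ | m
  · simp
  · exact not_lt.1 (Nat.find_min hlt (m := m) (by omega))

/-- The choice of parameters in the transcendence argument. -/
theorem exists_parameters (n d D : ℕ) (hn : 1 ≤ n) (hnd : n < d) {C : ℝ} (hC : 1 ≤ C) :
    ∃ S N T : ℕ, 1 ≤ S ∧ 1 ≤ N ∧ 1 ≤ T ∧ 2 * (T ^ n * S ^ n) ≤ N ^ d ∧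
      ∀ T' : ℕ, T ≤ T' → ∃ (R : ℝ) (E : ℕ), 4 * (S : ℝ) ≤ R ∧ 0 < R ∧
        (∀ r : ℕ, T' ≤ n * r → E ≤ S * r) ∧
        ∀ P : ℝ, P = C * (C * N ^ d * ((C * N) ^ (n * T) * C ^ (d * (n * (N * S))))) →
        (C ^ (d * (n * (N * S))) * (C ^ T' * ((T' : ℝ) ^ T' * ((N ^ d * P) * (C * N) ^ T' *
          Real.exp (C * N * (n * S)) * Real.exp (C * N * R) * (4 * S / R) ^ E)))) *
        (N ^ d * (P * C ^ (d * (n * (N * S))) * (C * N) ^ T')) ^ D < 1 := by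
  obtain ⟨p, hp⟩ : ∃ p, p = 1 + (1 + (n + 1) * d + ((n + 2) * n + 1)) := ⟨_, rfl⟩
  obtain ⟨h, hh⟩ : ∃ h, h = (n + 1) * d + (p + 1 + (n + 2)) := ⟨_, rfl⟩
  obtain ⟨e, he⟩ : ∃ e, e = 1 + (1 + (2 * (n + 1) +
    ((n + 1) * d + p + (n + 2) + 1 + 1))) + h * D := ⟨_, rfl⟩
  obtain ⟨S, hS⟩ : ∃ S, S = 2 * n * (e + 1) := ⟨_, rfl⟩
  have hS1 : 1 ≤ S := by rw [hS]; exact Nat.succ_le_of_lt (by positivity)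
  obtain ⟨M, hM⟩ : ∃ M, M = ⌈Real.exp (2 * C * S)⌉₊ + ⌈C⌉₊ + 2 * S + 2 * d * n * S ^ 2 +
    16 * S ^ 2 + 2 := ⟨_, rfl⟩
  have hMexp : Real.exp (2 * C * S) ≤ M := (Nat.le_ceil _).trans (by exact_mod_cast (by omega))
  have hMC : C ≤ M := (Nat.le_ceil _).trans (by exact_mod_cast (by omega))
  have hM1 : 2 ≤ M := by omega
  have hMS : 2 * S ≤ M := by omega
  have hMS2 : 2 * d * n * S ^ 2 ≤ M := by omega
  have hMS16 : 16 * S ^ 2 ≤ M := by omega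
  clear hM
  have hN1 : 1 ≤ 2 * S * M ^ n := Nat.succ_le_of_lt (by positivity)
  refine ⟨S, 2 * S * M ^ n, M ^ (n + 1), hS1, hN1, Nat.one_le_pow _ _ (by omega), ?_, ?_⟩
  · calc 2 * ((M ^ (n + 1)) ^ n * S ^ n) ≤ 2 ^ (n + 1) * (S ^ (n + 1) * (M ^ (n + 1)) ^ n) := by
          have h1 : S ^ n ≤ S ^ (n + 1) := Nat.pow_le_pow_right hS1 (by omega)
          have h2 : 2 ≤ 2 ^ (n + 1) := Nat.le_self_pow (by omega) 2
          rw [mul_comm _ (S ^ n)]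
          gcongr
      _ = (2 * S * M ^ n) ^ (n + 1) := by ring
      _ ≤ _ := Nat.pow_le_pow_right hN1 hnd
  intro T hT
  have hT1 : 1 ≤ T := (Nat.one_le_pow _ _ (by omega)).trans hT
  obtain ⟨m, hmT, hTm⟩ := exists_pow_le_lt_succ_pow n T
  have hMm : M ≤ m := by
    by_contra! hlt
    exact absurd (hT.trans_lt hTm) (not_lt.2 (Nat.pow_le_pow_left hlt _))
  have hm2 : 2 ≤ m := hM1.trans hMm
  have hmR : (2 : ℝ) ≤ m := by exact_mod_cast hm2
  have hSR : (1 : ℝ) ≤ S := by exact_mod_cast hS1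
  have hm16 : 16 * (S : ℝ) ^ 2 ≤ m := by exact_mod_cast hMS16.trans hMm
  have hMmR : (M : ℝ) ≤ m := by exact_mod_cast hMm
  have hMR : (2 : ℝ) ≤ M := by exact_mod_cast hM1
  have hMexpT : Real.exp (2 * C * S) ≤ m := hMexp.trans hMmR
  have hMCT : C ≤ m := hMC.trans hMmR
  refine ⟨m, 2 * (e + 1) * T, by nlinarith, by linarith, fun r hr => ?_, ?_⟩
  · rw [hS]
    calc 2 * (e + 1) * T ≤ 2 * (e + 1) * (n * r) := by gcongr
      _ = _ := by ring
  intro P hP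
  set X : ℝ := (m : ℝ) ^ T with hX
  have hmX : (m : ℝ) ≤ X := le_self_pow₀ (by linarith) (by omega)
  have hX1 : 1 < X := by linarith
  have hCX : C ≤ X := hMCT.trans hmX
  set N : ℕ := 2 * S * M ^ n with hN
  have hN1R : (1 : ℝ) ≤ N := by exact_mod_cast hN1
  have hNm : (N : ℝ) ≤ (m : ℝ) ^ (n + 1) := by
    have : N ≤ m ^ (n + 1) := by
      rw [hN, pow_succ, mul_comm]
      gcongr
      exact hMS.trans hMm
    exact_mod_cast this
  have hCN1 : 1 ≤ C * N := one_le_mul_of_one_le_of_one_le hC hN1R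
  have hCNm : C * N ≤ (m : ℝ) ^ (n + 2) := by
    rw [pow_succ, mul_comm]
    gcongr
  have hNd : (N : ℝ) ^ d ≤ X ^ ((n + 1) * d) := by
    rw [pow_mul]
    gcongr
    exact hNm.trans (by gcongr)
  have hCNT : (C * N) ^ T ≤ X ^ (n + 2) := by
    rw [hX, ← pow_mul, mul_comm T, pow_mul]
    gcongr
  have hCNnT : (C * N) ^ (n * M ^ (n + 1)) ≤ X ^ ((n + 2) * n) := by
    rw [mul_comm n, pow_mul, pow_mul]
    gcongr
    exact (pow_le_pow_right₀ hCN1 hT).trans hCNT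
  have hdeg : d * (n * (N * S)) ≤ T := by
    calc d * (n * (N * S)) = 2 * d * n * S ^ 2 * M ^ n := by rw [hN]; ring
      _ ≤ M * M ^ n := by gcongr
      _ = M ^ (n + 1) := by ring
      _ ≤ T := hT
  have hCdeg : C ^ (d * (n * (N * S))) ≤ X :=
    (pow_le_pow_right₀ hC hdeg).trans (by rw [hX]; gcongr)
  have hCT : C ^ T ≤ X := by rw [hX]; gcongr
  have hTT : (T : ℝ) ^ T ≤ X ^ (2 * (n + 1)) := by
    rw [hX, ← pow_mul, mul_comm T, pow_mul]
    gcongr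
    have : T ≤ m ^ (2 * (n + 1)) := by
      rw [pow_mul]
      exact hTm.le.trans (Nat.pow_le_pow_left (by nlinarith) _)
    exact_mod_cast this
  have hexp1 : Real.exp (C * N * m) ≤ X := by
    calc Real.exp (C * N * m) ≤ Real.exp (T * (2 * C * S)) := by
          refine Real.exp_le_exp.2 ?_
          have h1 : (M : ℝ) ^ n * m ≤ T := by
            calc (M : ℝ) ^ n * m ≤ (m : ℝ) ^ n * m := by gcongr
              _ ≤ T := by exact_mod_cast hmT
          calc C * N * m = 2 * C * S * ((M : ℝ) ^ n * m) := by rw [hN]; push_cast; ring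
            _ ≤ 2 * C * S * T := by gcongr
            _ = _ := by ring
      _ = Real.exp (2 * C * S) ^ T := Real.exp_nat_mul _ _
      _ ≤ X := by rw [hX]; gcongr
  have hexp2 : Real.exp (C * N * (n * S)) ≤ X := by
    refine le_trans ?_ hexp1
    gcongr
    have : n * S ≤ m := by
      refine le_trans ?_ (hMS2.trans hMm)
      calc n * S ≤ (2 * d) * (n * S) * S := by
            have : 1 ≤ 2 * d := by omega
            nlinarith [Nat.mul_le_mul this hS1, Nat.zero_le (n * S)]
        _ = _ := by ring
    exact_mod_cast this
  have hsmall : (4 * S / m : ℝ) ^ (2 * (e + 1) * T) ≤ (X ^ (e + 1))⁻¹ := by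
    have h1 : (4 * S / m : ℝ) ^ 2 ≤ (m : ℝ)⁻¹ := by
      rw [div_pow, div_le_iff₀ (by positivity)]
      calc (4 * (S : ℝ)) ^ 2 = (16 * (S : ℝ) ^ 2 : ℝ) := by ring
        _ ≤ (m : ℝ) := hm16
        _ = (m : ℝ)⁻¹ * (m : ℝ) ^ 2 := by field_simp
    calc (4 * S / m : ℝ) ^ (2 * (e + 1) * T) = ((4 * S / m : ℝ) ^ 2) ^ ((e + 1) * T) := by
          rw [← pow_mul, mul_assoc]
      _ ≤ ((m : ℝ)⁻¹) ^ ((e + 1) * T) := by gcongr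
      _ = _ := by rw [hX, inv_pow, ← pow_mul, mul_comm T]
  have hP0 : 0 ≤ P := by rw [hP]; positivity
  have hPX : P ≤ X ^ p := by
    calc P ≤ X * (X * X ^ ((n + 1) * d) * (X ^ ((n + 2) * n) * X)) := by rw [hP]; gcongr
      _ = X ^ p := by rw [hp]; ring
  have hhX : N ^ d * (P * C ^ (d * (n * (N * S))) * (C * N) ^ T) ≤ X ^ h := by
    calc _ ≤ X ^ ((n + 1) * d) * (X ^ p * X * X ^ (n + 2)) := by gcongr
      _ = X ^ h := by rw [hh]; ring
  calc _ ≤ (X * (X * (X ^ (2 * (n + 1)) * ((X ^ ((n + 1) * d) * X ^ p) * X ^ (n + 2) *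
          X * X * (X ^ (e + 1))⁻¹)))) * (X ^ h) ^ D := by gcongr
    _ = X ^ e * (X ^ (e + 1))⁻¹ := by
        generalize (X ^ (e + 1))⁻¹ = Z
        rw [he]
        ring
    _ < 1 := by
        rw [mul_inv_lt_iff₀ (by positivity), one_mul]
        exact pow_lt_pow_right₀ hX1 (by omega)

end LinearForms

theorem NumberField.house_le {K : Type*} [Field K] [NumberField K] {x : K} {B : ℝ}
    (h : ∀ σ : K →+* ℂ, ‖σ x‖ ≤ B) : house x ≤ B :=
  (pi_norm_le_iff_of_nonempty _).2 h

namespace LinearForms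

/-- Points of a group of algebraic points in dimension `card J`, which are the images under the
exponential map of points with algebraic coordinates in another basis, have rank at most
`card J`. -/
theorem not_injective_rowComb {L : Type*} [Field L] [NumberField L] (τ : L →+* ℂ) {I J : Type}
    [Fintype I] [Fintype J] [DecidableEq I] (hIJ : Fintype.card J < Fintype.card I)
    (x : I → J → 𝓞 L) (y : I → J → ℂ) (α : I → J → L)
    (hα : ∀ i j, Complex.exp (y i j) = τ (α i j)) (A B : J → J → ℂ)
    (hA : ∀ i j, y i j = ∑ j', A j j' * τ (x i j'))
    (hB : ∀ i j, τ (x i j) = ∑ j', B j j' * y i j') (j₀ : J) :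
    ¬ Function.Injective fun c : I → ℕ => rowComb x c j₀ := by
  intro hinj
  classical
  have : Nonempty J := ⟨j₀⟩
  obtain ⟨b, hb, W, hW⟩ : ∃ b : ℕ, b ≠ 0 ∧ ∃ W : I → J → 𝓞 L, ∀ i j, (W i j : L) = b * α i j := by
    have : Algebra.IsAlgebraic ℤ L :=
      (IsFractionRing.comap_isAlgebraic_iff (A := ℤ) (K := ℚ) (C := L)).2 inferInstance
    obtain ⟨z, hz, h⟩ := Algebra.IsAlgebraic.exists_integral_multiples ℤ (A := L)
      (Finset.univ.image fun ij : I × J => α ij.1 ij.2)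
    have hint (i : I) (j : J) : IsIntegral ℤ ((z.natAbs : L) * α i j) := by
      have h1 := h (α i j) (Finset.mem_image.2 ⟨(i, j), Finset.mem_univ _, rfl⟩)
      rw [zsmul_eq_mul] at h1
      rcases Int.natAbs_eq z with hz' | hz'
      · rwa [hz', Int.cast_natCast] at h1
      · rw [hz', Int.cast_neg, Int.cast_natCast, neg_mul] at h1
        simpa using h1.neg
    exact ⟨z.natAbs, Int.natAbs_ne_zero.2 hz, fun i j => ⟨_, hint i j⟩, fun _ _ => rfl⟩
  obtain ⟨C₁, hC₁, hsiegel⟩ := NumberField.exists_siegel_const L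
  obtain ⟨a, ha⟩ := Finite.exists_le fun jj : J × J => max ‖A jj.1 jj.2‖ ‖B jj.1 jj.2‖
  obtain ⟨m₁, hm₁⟩ := Finite.exists_le fun σj : (L →+* ℂ) × J => ∑ i, ‖σj.1 (x i σj.2)‖
  obtain ⟨m₂, hm₂⟩ := Finite.exists_le fun σij : (L →+* ℂ) × I × J =>
    ‖σij.1 (W σij.2.1 σij.2.2)‖
  obtain ⟨m₃, hm₃⟩ := Finite.exists_le fun j : J => ∑ i, ‖y i j‖
  obtain ⟨C, hC⟩ : ∃ C : ℝ, C = max C₁ (max b (max (Fintype.card J * a) (max m₁ (max m₂ m₃)))) :=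
    ⟨_, rfl⟩
  have hCC₁ : C₁ ≤ C := by simp [hC]
  have hCb : (b : ℝ) ≤ C := by simp [hC]
  have hCa : Fintype.card J * a ≤ C := by simp [hC]
  have hCx (σ : L →+* ℂ) (j : J) : ∑ i, ‖σ (x i j)‖ ≤ C := (hm₁ (σ, j)).trans (by simp [hC])
  have hCW (σ : L →+* ℂ) (i : I) (j : J) : ‖σ (W i j)‖ ≤ C := (hm₂ (σ, i, j)).trans (by simp [hC])
  have hCy (j : J) : ∑ i, ‖y i j‖ ≤ C := (hm₃ j).trans (by simp [hC])
  have hC1 : 1 ≤ C := hC₁.trans hCC₁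
  clear hC hm₁ hm₂ hm₃
  have ha0 : 0 ≤ a := (norm_nonneg (A j₀ j₀)).trans ((le_max_left _ _).trans (ha (j₀, j₀)))
  obtain ⟨S, N, T, hS, hN, hT, hsize, hpar⟩ := exists_parameters (Fintype.card J) (Fintype.card I)
    (Module.finrank ℚ L - 1) Fintype.card_pos hIJ hC1
  have hN1 : (1 : ℝ) ≤ N := by exact_mod_cast hN
  have hCN1 : 1 ≤ C * N := one_le_mul_of_one_le_of_one_le hC1 hN1
  obtain ⟨M, hM⟩ : ∃ M, M = Fintype.card I * (Fintype.card J * (N * S)) := ⟨_, rfl⟩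
  obtain ⟨P, hP⟩ : ∃ P, P = C * (C * N ^ Fintype.card I *
    ((C * N) ^ (Fintype.card J * T) * C ^ M)) := ⟨_, rfl⟩
  obtain ⟨ξ, hξ, hvan, hξP⟩ : ∃ ξ : (I → Fin N) → 𝓞 L, ξ ≠ 0 ∧
      (∀ k s : J → ℕ, (∀ j, k j < T) → (∀ j, s j < S) → auxValue b x W M ξ k s = 0) ∧
      ∀ c, house (ξ c : L) ≤ P := by
    refine (hsiegel ((J → Fin T) × (J → Fin S)) (I → Fin N)
      (fun ks c => homMonomial b W M (fun i => c i) (fun j => ks.2 j) *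
        ∏ j, rowComb x (fun i => c i) j ^ (ks.1 j : ℕ))
      ((C * N) ^ (Fintype.card J * T) * C ^ M) ?_ ?_ ?_ ?_ ?_).imp
        fun ξ ⟨hξ, h0, hle⟩ => ⟨hξ, fun k s hk hs => ?_, fun c => (hle c).trans ?_⟩
    · intro h
      have := congrFun (congrFun h (fun _ => ⟨0, hT⟩, fun _ => ⟨0, hS⟩)) (fun _ => ⟨0, hN⟩)
      simp [homMonomial, hb] at this
    · have : Nonempty (Fin T) := ⟨⟨0, hT⟩⟩
      have : Nonempty (Fin S) := ⟨⟨0, hS⟩⟩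
      exact Fintype.card_pos
    · simpa using hsize
    · exact one_le_mul_of_one_le_of_one_le (one_le_pow₀ hCN1) (one_le_pow₀ hC1)
    · rintro ⟨k, s⟩ c
      refine house_le fun σ => ?_
      have hc (i : I) : (c i : ℕ) ≤ N := (c i).is_lt.le
      have h1 : ‖(σ.comp (algebraMap (𝓞 L) L)) (homMonomial b W M (fun i => c i)
          (fun j => s j))‖ ≤ C ^ M := by
        rw [map_homMonomial]
        exact norm_homMonomial_le hCb (fun i j => hCW σ i j)
          (hM ▸ sum_sum_mul_le hc fun j => (s j).is_lt.le)
      have h2 : ‖(σ.comp (algebraMap (𝓞 L) L)) (∏ j, rowComb x (fun i => c i) j ^ (k j : ℕ))‖ ≤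
          (C * N) ^ (Fintype.card J * T) := by
        simp only [map_prod, map_pow, map_rowComb]
        refine (norm_prod_rowComb_pow_le (fun j => hCx σ j) hc _).trans ?_
        refine pow_le_pow_right₀ hCN1 ?_
        simpa using Finset.sum_le_card_nsmul Finset.univ (fun j => (k j : ℕ)) T
          fun j _ => (k j).is_lt.le
      rw [mul_comm (_ ^ _)]
      calc _ = ‖(σ.comp (algebraMap (𝓞 L) L)) (homMonomial b W M (fun i => c i) (fun j => s j))‖ *
            ‖(σ.comp (algebraMap (𝓞 L) L)) (∏ j, rowComb x (fun i => c i) j ^ (k j : ℕ))‖ := by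
              rw [← norm_mul, ← map_mul]
              rfl
        _ ≤ _ := by gcongr
    · have := congrFun h0 (fun j => ⟨k j, hk j⟩, fun j => ⟨s j, hs j⟩)
      rw [Pi.zero_apply] at this
      rw [← this]
      simp only [auxValue, Matrix.mulVec, dotProduct]
      exact Finset.sum_congr rfl fun c _ => by ring
    · rw [hP]
      have : (Fintype.card (I → Fin N) : ℝ) = N ^ Fintype.card I := by simp
      rw [this]
      gcongr
  have hex : ∃ t, ∃ k s : J → ℕ, ∑ j, k j = t ∧ (∀ j, s j < S) ∧ auxValue b x W M ξ k s ≠ 0 := by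
    obtain ⟨k, hk⟩ := exists_auxValue_ne_zero hb x W M j₀ hinj hξ
    exact ⟨_, k, 0, rfl, fun _ => hS, hk⟩
  obtain ⟨T', hT'⟩ : ∃ T', T' = Nat.find hex := ⟨_, rfl⟩
  obtain ⟨k, s, hk, hs, hne⟩ := Nat.find_spec hex
  have hmin (k s : J → ℕ) (hk : ∑ j, k j < T') (hs : ∀ j, s j < S) :
      auxValue b x W M ξ k s = 0 := by
    by_contra h
    exact Nat.find_min hex (hT' ▸ hk) ⟨k, s, rfl, hs, h⟩
  rw [← hT'] at hk
  have hTT' : T ≤ T' := by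
    by_contra! hlt
    refine hne (hvan k s (fun j => ?_) hs)
    exact (Finset.single_le_sum (f := k) (fun _ _ => Nat.zero_le _)
      (Finset.mem_univ j)).trans_lt (hk ▸ hlt)
  obtain ⟨R, E, hSR, hR, hE, hlt⟩ := hpar T' hTT'
  have hfinal := hlt P (by rw [hP, hM])
  rw [← hM] at hfinal
  refine absurd (NumberField.one_le_norm_mul_house_pow τ hne) (not_le.2 (lt_of_le_of_lt ?_ hfinal))
  have hP0 : 0 ≤ P := by rw [hP]; positivity
  have hhouse : house (algebraMap (𝓞 L) L (auxValue b x W M ξ k s)) ≤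
      N ^ Fintype.card I * (P * C ^ M * (C * N) ^ T') := by
    refine house_le fun σ => ?_
    have h := norm_auxValue_le (x := fun i j => σ (x i j)) (W := fun i j => σ (W i j))
      (p := fun c => σ (ξ c)) hCb (fun j => hCx σ j) (fun i j => hCW σ i j)
      (fun c => (norm_embedding_le_house _ σ).trans (hξP c)) k s fun j => (hs j).le
    rw [← hM, hk] at h
    refine le_of_eq_of_le (congrArg norm ?_) h
    exact map_auxValue (σ.comp (algebraMap (𝓞 L) L)) b x W M ξ k s
  have hτ (k s : J → ℕ) (hs : ∀ j, s j < S) : τ (algebraMap (𝓞 L) L (auxValue b x W M ξ k s)) =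
      b ^ M * ∑ c, τ (ξ c) * Complex.exp (∑ j, rowComb y (fun i => c i) j * s j) *
        ∏ j, rowComb (fun i j => τ (x i j)) (fun i => c i) j ^ k j := by
    have h := auxValue_eq_cexp (x := fun i j => τ (x i j)) (W := fun i j => τ (W i j)) (y := y)
      (b := b) (by intro i j; rw [hα, hW, map_mul, map_natCast]) (p := fun c => τ (ξ c)) k s
      fun j => (hs j).le
    rw [← hM] at h
    rw [← h]
    exact map_auxValue (τ.comp (algebraMap (𝓞 L) L)) b x W M ξ k s
  have hb0 : (b : ℂ) ^ M ≠ 0 := pow_ne_zero _ (Nat.cast_ne_zero.2 hb)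
  have hrow (A : J → J → ℂ) (u v : I → J → ℂ) (h : ∀ i j, u i j = ∑ j', A j j' * v i j')
      (c : I → ℕ) (j : J) : rowComb u c j = ∑ j', A j j' * rowComb v c j' := by
    simp_rw [rowComb, h, Finset.mul_sum]
    rw [Finset.sum_comm]
    exact Finset.sum_congr rfl fun _ _ => Finset.sum_congr rfl fun _ _ => by ring
  have hup := norm_sum_mul_prod_pow_mul_cexp_le (fun c : I → Fin N => τ (ξ c))
    (fun c => rowComb (fun i j => τ (x i j)) (fun i => c i)) (fun c => rowComb y (fun i => c i))
    A B (a := a) (U := C * N) (fun c => hrow A y _ hA _) (fun c => hrow B _ y hB _)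
    (fun j j' => (le_max_left _ _).trans (ha (j, j')))
    (fun j j' => (le_max_right _ _).trans (ha (j, j')))
    (fun c j => norm_rowComb_le y j (hCy j) fun i => (c i).is_lt.le) hCN1 hSR hR hE
    (fun k s hk hs => (mul_eq_zero.1 ((hτ k s hs).symm.trans
      (by rw [hmin k s hk hs]; simp))).resolve_left hb0) k s hk hs
  have hsum : ∑ c : I → Fin N, ‖τ (ξ c)‖ ≤ N ^ Fintype.card I * P := by
    calc _ ≤ ∑ _c : I → Fin N, P :=
          Finset.sum_le_sum fun c _ => (norm_embedding_le_house _ τ).trans (hξP c)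
      _ = _ := by simp
  have hnorm : ‖τ (algebraMap (𝓞 L) L (auxValue b x W M ξ k s))‖ ≤ C ^ M * (C ^ T' * ((T' : ℝ) ^ T' *
      ((N ^ Fintype.card I * P) * (C * N) ^ T' * Real.exp (C * N * (Fintype.card J * S)) *
        Real.exp (C * N * R) * (4 * S / R) ^ E))) := by
    rw [hτ k s hs, norm_mul, norm_pow, Complex.norm_natCast]
    gcongr
    refine hup.trans ?_
    gcongr
  have h0 := house_nonneg (algebraMap (𝓞 L) L (auxValue b x W M ξ k s))
  gcongr

end LinearForms

/-- Distinct characters of a monoid are separated by as many points. -/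
theorem exists_isUnit_of_monoidHom {M k J : Type*} [Monoid M] [Field k] [Fintype J] [DecidableEq J]
    {χ : J → M →* k} (hχ : Function.Injective χ) :
    ∃ a : J → M, IsUnit (Matrix.of fun j σ => χ σ (a j)) := by
  set v : M → J → k := fun m σ => χ σ m with hv
  have hspan : Submodule.span k (Set.range v) = ⊤ := by
    by_contra hne
    obtain ⟨f, hf0, hf⟩ := Submodule.exists_le_ker_of_lt_top _ (lt_top_iff_ne_top.2 hne)
    have hlin := Fintype.linearIndependent_iff.1 ((linearIndependent_monoidHom M k).comp χ hχ)
      (fun σ => f (Pi.single σ 1)) (by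
        funext m
        have hm : f (v m) = 0 := hf (Submodule.subset_span ⟨m, rfl⟩)
        have hsingle (σ : J) : (fun τ => if σ = τ then (1 : k) else 0) = Pi.single σ 1 := by
          ext τ
          simp [Pi.single_apply, eq_comm]
        rw [LinearMap.pi_apply_eq_sum_univ] at hm
        simp_rw [hsingle] at hm
        simpa [mul_comm, v] using hm)
    refine hf0 (LinearMap.pi_ext' fun σ => LinearMap.ext_ring ?_)
    simpa using hlin σ
  obtain ⟨b, hb, hbspan, hblin⟩ := exists_linearIndependent k (Set.range v)
  let B := Module.Basis.mk hblin (by simp [hbspan, hspan])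
  have e : Nonempty (J ≃ b) := B.indexEquiv (Pi.basisFun k J) |>.symm |> Nonempty.intro
  obtain ⟨e⟩ := e
  choose g hg using fun s : b => hb s.2
  refine ⟨fun j => g (e j), Matrix.linearIndependent_rows_iff_isUnit.1 ?_⟩
  have hrow : (Matrix.of fun j σ => χ σ (g (e j))).row = Subtype.val ∘ e := funext fun j => hg (e j)
  rw [hrow]
  exact hblin.comp e e.injective

theorem Complex.exp_sum_intCast_mul_mem {ι : Type*} [Fintype ι] (F : IntermediateField ℚ ℂ)
    (lam : ι → ℂ) (h : ∀ k, Complex.exp (lam k) ∈ F) (n : ι → ℤ) :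
    Complex.exp (∑ k, n k * lam k) ∈ F := by
  rw [Complex.exp_sum]
  refine prod_mem fun k _ => ?_
  rw [Complex.exp_int_mul]
  exact zpow_mem (h k) _

theorem sum_algHom_mul_eq_zero_of_isIntegral {K : Type} [Field K] [NumberField K] {ι : Type*}
    [Fintype ι] (lam : ι → ℂ) (hlam : ∀ k, IsAlgebraic ℚ (Complex.exp (lam k))) (β : ι → 𝓞 K)
    (σ₀ : K →ₐ[ℚ] ℂ) (h₀ : ∑ k, σ₀ (β k) * lam k = 0) (σ : K →ₐ[ℚ] ℂ) :
    ∑ k, σ (β k) * lam k = 0 := by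
  classical
  by_contra hσ
  set Λ : (K →ₐ[ℚ] ℂ) → ℂ := fun σ => ∑ k, σ (β k) * lam k with hΛ
  let J := {σ : K →ₐ[ℚ] ℂ // Λ σ ≠ 0}
  let j₀ : J := ⟨σ, hσ⟩
  let I := Fin (Module.finrank ℤ (𝓞 K))
  let γ : Module.Basis I ℤ (𝓞 K) := Module.finBasis ℤ (𝓞 K)
  have hIJ : Fintype.card J < Fintype.card I := by
    rw [Fintype.card_fin, RingOfIntegers.rank, ← AlgHom.card ℚ K ℂ]
    exact Fintype.card_subtype_lt (x := σ₀) (by simpa using h₀)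
  obtain ⟨a, ha⟩ := exists_isUnit_of_monoidHom (M := 𝓞 K) (k := ℂ) (J := J)
    (χ := fun σ => (((σ.1 : K →+* ℂ).comp (algebraMap (𝓞 K) K) : 𝓞 K →+* ℂ) : 𝓞 K →* ℂ)) (by
      intro σ σ' h
      refine Subtype.ext (AlgHom.coe_ringHom_injective (IsFractionRing.ringHom_ext (A := 𝓞 K) ?_))
      exact fun x => DFunLike.congr_fun h x)
  let F : IntermediateField ℚ ℂ :=
    (⨆ σ : K →ₐ[ℚ] ℂ, σ.fieldRange) ⊔ IntermediateField.adjoin ℚ (Set.range fun k =>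
      Complex.exp (lam k))
  have hfd1 : FiniteDimensional ℚ (IntermediateField.adjoin ℚ (Set.range fun k =>
      Complex.exp (lam k))) := by
    refine IntermediateField.finiteDimensional_adjoin ?_
    rintro _ ⟨k, rfl⟩
    exact (hlam k).isIntegral
  have hfd2 (σ : K →ₐ[ℚ] ℂ) : FiniteDimensional ℚ σ.fieldRange :=
    σ.toLinearMap.finiteDimensional_range
  have hfd : FiniteDimensional ℚ F := inferInstance
  have hF : NumberField F := ⟨⟩
  have hexp (k : ι) : Complex.exp (lam k) ∈ F :=
    (le_sup_right : _ ≤ F) (IntermediateField.subset_adjoin _ _ ⟨k, rfl⟩)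
  let σF (σ : K →ₐ[ℚ] ℂ) : K →ₐ[ℚ] F := σ.codRestrict F.toSubalgebra fun x =>
    (le_sup_left : _ ≤ F) ((le_iSup (fun σ : K →ₐ[ℚ] ℂ => σ.fieldRange) σ) ⟨x, rfl⟩)
  let y : I → J → ℂ := fun i j => ∑ σ : J, σ.1 (a j) * Λ σ.1 * σ.1 (γ i)
  have hy (i : I) (j : J) :
      y i j = ∑ k, (Algebra.trace ℤ (𝓞 K) (γ i * a j * β k) : ℂ) * lam k := by
    have htr (k : ι) : (Algebra.trace ℤ (𝓞 K) (γ i * a j * β k) : ℂ) =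
        ∑ σ : K →ₐ[ℚ] ℂ, σ (γ i) * σ (a j) * σ (β k) := by
      have h1 := trace_eq_sum_embeddings ℂ (K := ℚ) (L := K) (x := (γ i * a j * β k : 𝓞 K))
      rw [← Algebra.coe_trace_int] at h1
      simpa using h1
    simp_rw [htr, Finset.sum_mul]
    rw [Finset.sum_comm]
    have hsub : y i j = ∑ σ : K →ₐ[ℚ] ℂ, σ (a j) * Λ σ * σ (γ i) := by
      rw [← Finset.sum_filter_of_ne (p := fun σ => Λ σ ≠ 0)
        fun σ _ h h0 => h (by rw [h0, mul_zero, zero_mul])]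
      exact (Finset.sum_subtype _ (p := fun σ => Λ σ ≠ 0) (by simp)
        fun σ : K →ₐ[ℚ] ℂ => σ (a j) * Λ σ * σ (γ i)).symm
    rw [hsub]
    refine Finset.sum_congr rfl fun σ _ => ?_
    rw [hΛ, Finset.mul_sum, Finset.sum_mul]
    exact Finset.sum_congr rfl fun k _ => by ring
  let A : Matrix J J ℂ := Matrix.of fun j σ => σ.1 (a j) * Λ σ.1
  have hA : IsUnit A := by
    have : A = (Matrix.of fun j (σ : J) => σ.1 (a j : K)) * Matrix.diagonal fun σ : J => Λ σ.1 := by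
      ext j σ
      simp [A, Matrix.mul_diagonal]
    rw [this]
    refine ha.mul ?_
    rw [Matrix.isUnit_diagonal, Pi.isUnit_iff]
    exact fun σ => isUnit_iff_ne_zero.2 σ.2
  have hdet := (Matrix.isUnit_iff_isUnit_det A).1 hA
  refine LinearForms.not_injective_rowComb (L := F) F.val.toRingHom hIJ
    (fun i σ => RingOfIntegers.mapRingHom (σF σ.1).toRingHom (γ i)) y
    (fun i j => ⟨Complex.exp (y i j), ?_⟩) (fun _ _ => rfl) A (A⁻¹ : Matrix J J ℂ) (fun i j => rfl) ?_ j₀ ?_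
  · rw [hy]
    exact Complex.exp_sum_intCast_mul_mem F lam hexp _
  · intro i j
    have h1 : y i = A.mulVec fun σ => σ.1 (γ i) := rfl
    have h2 : A⁻¹.mulVec (y i) = fun σ : J => σ.1 (γ i : K) := by
      rw [h1, Matrix.mulVec_mulVec, Matrix.nonsing_inv_mul _ hdet, Matrix.one_mulVec]
    change j.1 (γ i : K) = A⁻¹.mulVec (y i) j
    rw [h2]
  · intro c c' h
    have h1 (c : I → ℕ) : LinearForms.rowComb (fun i (σ : J) =>
        RingOfIntegers.mapRingHom (σF σ.1).toRingHom (γ i)) c j₀ =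
        RingOfIntegers.mapRingHom (σF σ).toRingHom (∑ i, (c i : ℤ) • γ i) := by
      simp [LinearForms.rowComb, j₀]
    simp only [h1] at h
    have h2 : ∑ i, (c i : ℤ) • γ i = ∑ i, (c' i : ℤ) • γ i :=
      RingOfIntegers.ext ((σF σ).toRingHom.injective (congrArg (algebraMap (𝓞 F) F) h))
    have h3 := Fintype.linearIndependent_iff.1 γ.linearIndependent (fun i => (c i : ℤ) - c' i)
      (by simp_rw [sub_smul, Finset.sum_sub_distrib, h2, sub_self])
    funext i
    have := h3 i
    omega

/-- A consequence of **Baker's theorem**: linear relations with algebraic coefficients between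
logarithms of algebraic numbers are preserved by conjugating the coefficients. -/
theorem sum_algHom_mul_eq_zero {K : Type} [Field K] [NumberField K] {ι : Type*}
    [Fintype ι] (lam : ι → ℂ) (hlam : ∀ k, IsAlgebraic ℚ (Complex.exp (lam k))) (β : ι → K)
    (σ₀ : K →ₐ[ℚ] ℂ) (h₀ : ∑ k, σ₀ (β k) * lam k = 0) (σ : K →ₐ[ℚ] ℂ) :
    ∑ k, σ (β k) * lam k = 0 := by
  classical
  have : Algebra.IsAlgebraic ℤ K :=
    (IsFractionRing.comap_isAlgebraic_iff (A := ℤ) (K := ℚ) (C := K)).2 inferInstance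
  obtain ⟨z, hz, h⟩ := Algebra.IsAlgebraic.exists_integral_multiples ℤ (A := K)
    (Finset.univ.image β)
  obtain ⟨β', hβ'⟩ : ∃ β' : ι → 𝓞 K, ∀ k, (β' k : K) = z * β k :=
    ⟨fun k => ⟨z * β k, zsmul_eq_mul (β k) z ▸
      h (β k) (Finset.mem_image.2 ⟨k, Finset.mem_univ _, rfl⟩)⟩, fun _ => rfl⟩
  have key (σ : K →ₐ[ℚ] ℂ) : ∑ k, σ (β' k) * lam k = z * ∑ k, σ (β k) * lam k := by
    simp_rw [hβ', Finset.mul_sum, map_mul, map_intCast, mul_assoc]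
  have h1 := sum_algHom_mul_eq_zero_of_isIntegral lam hlam β' σ₀ (by rw [key, h₀, mul_zero]) σ
  rw [key] at h1
  exact (mul_eq_zero.1 h1).resolve_left (Int.cast_ne_zero.2 hz)

end NumberField

section LSeries

open Filter Topology

/-- An Abelian theorem: if `∑ b i` converges to `l`, then so do the sums of the series weighted by
antitone weights which tend to `1` pointwise. -/
theorem tendsto_of_tendsto_sum_mul_antitone {ι : Type*} {F : Filter ι} {b : ℕ → ℂ} {l : ℂ}
    (hb : Tendsto (fun N ↦ ∑ i ∈ Finset.range N, b i) atTop (𝓝 l)) {g : ι → ℕ → ℝ}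
    (hanti : ∀ x, Antitone (g x)) (hnonneg : ∀ x n, 0 ≤ g x n) (hzero : ∀ x, g x 0 = 1)
    (hg : ∀ n, Tendsto (fun x ↦ g x n) F (𝓝 1)) {v : ι → ℂ}
    (hv : ∀ x, Tendsto (fun N ↦ ∑ i ∈ Finset.range N, (g x i : ℂ) * b i) atTop (𝓝 (v x))) :
    Tendsto v F (𝓝 l) := by
  set S : ℕ → ℂ := fun N ↦ ∑ i ∈ Finset.range N, b i with hS
  have hSl : Tendsto (fun N ↦ ‖S N - l‖) atTop (𝓝 0) := by
    simpa using (hb.sub_const l).norm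
  obtain ⟨C, hC⟩ := hSl.bddAbove_range
  have hC' : ∀ n, ‖S n - l‖ ≤ C := fun n ↦ hC ⟨n, rfl⟩
  have hC0 : 0 ≤ C := (norm_nonneg _).trans (hC' 0)
  have parts : ∀ x N, (∑ i ∈ Finset.range N, (g x i : ℂ) * b i) - l =
      (g x N : ℂ) * (S N - l) + ∑ i ∈ Finset.range N, ((g x i - g x (i + 1) : ℝ) : ℂ) *
        (S (i + 1) - l) := by
    intro x N
    induction N with
    | zero => simp [hS, hzero]
    | succ N ih =>
      have h1 : S (N + 1) = S N + b N := Finset.sum_range_succ _ _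
      rw [Finset.sum_range_succ, Finset.sum_range_succ _ N, h1]
      push_cast at ih ⊢
      linear_combination ih
  have bound : ∀ δ > 0, ∃ M, ∀ x, ‖v x - l‖ ≤ C * (1 - g x M) + δ := by
    intro δ hδ
    obtain ⟨M, hM⟩ := eventually_atTop.1 (hSl.eventually (gt_mem_nhds hδ))
    refine ⟨M, fun x ↦ ?_⟩
    have key : ∀ N, ‖(∑ i ∈ Finset.range N, (g x i : ℂ) * b i) - l‖ ≤
        ‖S N - l‖ + (C * (1 - g x M) + δ) := by
      intro N
      rw [parts]
      refine (norm_add_le _ _).trans (add_le_add ?_ ?_)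
      · rw [norm_mul, Complex.norm_of_nonneg (hnonneg x N)]
        exact mul_le_of_le_one_left (norm_nonneg _) ((hanti x N.zero_le).trans_eq (hzero x))
      · have hstep : ∀ i, ‖((g x i - g x (i + 1) : ℝ) : ℂ) * (S (i + 1) - l)‖ ≤
            (C * max (g x i) (g x M) + δ * g x i) -
              (C * max (g x (i + 1)) (g x M) + δ * g x (i + 1)) := by
          intro i
          have hd : 0 ≤ g x i - g x (i + 1) := sub_nonneg.2 (hanti x i.le_succ)
          rw [norm_mul, Complex.norm_of_nonneg hd]
          rcases lt_or_ge i M with h | h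
          · rw [max_eq_left (hanti x h.le), max_eq_left (hanti x (Nat.succ_le_of_lt h))]
            nlinarith [mul_le_mul_of_nonneg_left (hC' (i + 1)) hd, mul_nonneg hδ.le hd]
          · rw [max_eq_right (hanti x h), max_eq_right (hanti x (h.trans i.le_succ))]
            nlinarith [mul_le_mul_of_nonneg_left (hM (i + 1) (h.trans i.le_succ)).le hd]
        refine (norm_sum_le_of_le _ fun i _ ↦ hstep i).trans ?_
        rw [Finset.sum_range_sub', hzero, max_eq_left ((hanti x M.zero_le).trans_eq (hzero x))]
        have h2 : g x M ≤ max (g x N) (g x M) := le_max_right _ _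
        nlinarith [mul_le_mul_of_nonneg_left h2 hC0, mul_nonneg hδ.le (hnonneg x N)]
    have h3 := le_of_tendsto_of_tendsto' ((hv x).sub_const l).norm
      (hSl.add_const (C * (1 - g x M) + δ)) key
    simpa using h3
  rw [Metric.tendsto_nhds]
  intro ε hε
  obtain ⟨M, hM⟩ := bound (ε / 2) (half_pos hε)
  have h4 : Tendsto (fun x ↦ C * (1 - g x M) + ε / 2) F (𝓝 (C * (1 - 1) + ε / 2)) :=
    (((hg M).const_sub 1).const_mul C).add_const _
  filter_upwards [h4.eventually (gt_mem_nhds (show C * (1 - 1) + ε / 2 < ε by linarith))] with x hx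
  rw [dist_eq_norm]
  exact (hM x).trans_lt hx

theorem eq_LFunction_one_of_tendsto {q : ℕ} [NeZero q] {χ : DirichletCharacter ℂ q} (hχ : χ ≠ 1)
    {l : ℂ} (hl : Tendsto (fun N : ℕ ↦ ∑ n ∈ Finset.range N, χ (n : ZMod q) / (n : ℂ)) atTop (𝓝 l)) :
    l = DirichletCharacter.LFunction χ 1 := by
  have hcont : Tendsto (fun t : Set.Ioi (0 : ℝ) ↦
      DirichletCharacter.LFunction χ (((1 + t : ℝ) : ℝ) : ℂ)) (comap Subtype.val (𝓝[>] 0))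
      (𝓝 (DirichletCharacter.LFunction χ 1)) := by
    have h1 : ContinuousAt (fun t : ℝ ↦ DirichletCharacter.LFunction χ ((1 + t : ℝ) : ℂ)) 0 := by
      have := (DirichletCharacter.differentiable_LFunction hχ).continuous
      fun_prop
    have h2 := h1.tendsto
    simp only [add_zero, Complex.ofReal_one] at h2
    exact (h2.mono_left nhdsWithin_le_nhds).comp tendsto_comap
  have hne : (comap (Subtype.val : Set.Ioi (0 : ℝ) → ℝ) (𝓝[>] 0)).NeBot :=
    comap_coe_neBot_of_le_principal inf_le_right
  refine tendsto_nhds_unique (tendsto_of_tendsto_sum_mul_antitone hl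
    (g := fun (t : Set.Ioi (0 : ℝ)) n ↦ (max (n : ℝ) 1) ^ (-(t : ℝ))) ?_ ?_ ?_ ?_ ?_) hcont
  · intro t m n hmn
    refine Real.rpow_le_rpow_of_nonpos (by positivity) ?_ (neg_nonpos.2 (le_of_lt t.2))
    exact max_le_max (by exact_mod_cast hmn) le_rfl
  · intro t n
    positivity
  · simp
  · intro n
    have h1 : ContinuousAt (fun t : ℝ ↦ (max (n : ℝ) 1) ^ (-t)) 0 := by
      refine ContinuousAt.rpow continuousAt_const continuousAt_id.neg (Or.inl ?_)
      positivity
    have h2 := h1.tendsto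
    simp only [neg_zero, Real.rpow_zero] at h2
    exact (h2.mono_left nhdsWithin_le_nhds).comp tendsto_comap
  · intro t
    have ht : 1 < ((((1 + t : ℝ) : ℝ) : ℂ)).re := by
      have : (0 : ℝ) < t := t.2
      rw [Complex.ofReal_re]
      linarith
    rw [DirichletCharacter.LFunction_eq_LSeries χ ht]
    have h1 := (DirichletCharacter.LSeriesSummable_of_one_lt_re χ ht).hasSum.tendsto_sum_nat
    refine h1.congr fun N ↦ Finset.sum_congr rfl fun n _ ↦ ?_
    rcases eq_or_ne n 0 with rfl | hn
    · simp
    · have hn' : (1 : ℝ) ≤ n := by exact_mod_cast Nat.one_le_iff_ne_zero.2 hn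
      have hn0 : (n : ℂ) ≠ 0 := by exact_mod_cast hn
      rw [LSeries.term_of_ne_zero hn, max_eq_left hn', Complex.ofReal_cpow n.cast_nonneg]
      push_cast
      rw [Complex.cpow_add _ _ hn0, Complex.cpow_one, Complex.cpow_neg]
      field_simp

theorem norm_stdAddChar {q : ℕ} [NeZero q] (a : ZMod q) : ‖ZMod.stdAddChar a‖ = 1 :=
  AddChar.norm_apply _ a

theorem one_sub_mem_slitPlane_of_norm_eq_one {z : ℂ} (hz : ‖z‖ = 1) (h1 : z ≠ 1) :
    1 - z ∈ Complex.slitPlane := by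
  rw [Complex.mem_slitPlane_iff, Complex.sub_re, Complex.one_re, sub_pos, Complex.sub_im,
    Complex.one_im, zero_sub, neg_ne_zero]
  by_contra! h
  have h2 : z.re * z.re + z.im * z.im = 1 := by
    rw [← Complex.normSq_apply, ← Complex.sq_norm, hz, one_pow]
  rw [h.2] at h2
  exact h1 (Complex.ext (by simp; nlinarith) (by simpa using h.2))

/-- The sum of `f n / n` for a periodic function `f`, in terms of the finite Fourier expansion
of `f`. -/
theorem eq_neg_sum_mul_log_of_tendsto {q : ℕ} [NeZero q] {G : ZMod q → ℂ} (hG : G 0 = 0) {l : ℂ}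
    (hl : Tendsto (fun N : ℕ ↦ ∑ n ∈ Finset.range N,
      (∑ a, G a * ZMod.stdAddChar (a * (n : ZMod q))) / (n : ℂ)) atTop (𝓝 l)) :
    l = -∑ a, G a * Complex.log (1 - ZMod.stdAddChar a) := by
  have h1 := Complex.tendsto_tsum_powerSeries_nhdsWithin_lt hl
  rw [tendsto_map'_iff] at h1
  refine tendsto_nhds_unique h1 ?_
  have h2 : Tendsto (fun x : ℝ ↦ -∑ a, G a * Complex.log (1 - ZMod.stdAddChar a * (x : ℂ)))
      (𝓝[<] 1) (𝓝 (-∑ a, G a * Complex.log (1 - ZMod.stdAddChar a))) := by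
    refine (tendsto_finsetSum _ fun a _ ↦ ?_).neg
    rcases eq_or_ne a 0 with rfl | ha
    · simp [hG]
    · have hne : ZMod.stdAddChar a ≠ (1 : ℂ) := fun h ↦
        ha (ZMod.injective_stdAddChar (h.trans (AddChar.map_zero_eq_one _).symm))
      have hc : ContinuousAt
          (fun x : ℝ ↦ G a * Complex.log (1 - ZMod.stdAddChar a * (x : ℂ))) 1 := by
        refine continuousAt_const.mul (ContinuousAt.clog (by fun_prop) ?_)
        simpa using one_sub_mem_slitPlane_of_norm_eq_one (norm_stdAddChar a) hne
      have h3 := hc.tendsto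
      simp only [Complex.ofReal_one, mul_one] at h3
      exact h3.mono_left nhdsWithin_le_nhds
  refine h2.congr' ?_
  filter_upwards [Ioo_mem_nhdsLT (zero_lt_one (α := ℝ))] with x hx
  have hs : ∀ a : ZMod q, HasSum (fun n : ℕ ↦ G a * ((ZMod.stdAddChar a * (x : ℂ)) ^ n / n))
      (G a * -Complex.log (1 - ZMod.stdAddChar a * (x : ℂ))) := fun a ↦ by
    refine (Complex.hasSum_taylorSeries_neg_log ?_).mul_left _
    rw [norm_mul, norm_stdAddChar, one_mul, Complex.norm_of_nonneg hx.1.le]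
    exact hx.2
  have h4 := (hasSum_sum fun a (_ : a ∈ Finset.univ) ↦ hs a).tsum_eq
  simp only [Function.comp_apply]
  rw [← Finset.sum_neg_distrib]
  simp only [mul_neg] at h4
  rw [← h4]
  refine tsum_congr fun n ↦ ?_
  rw [Finset.sum_div, Finset.sum_mul]
  refine Finset.sum_congr rfl fun a _ ↦ ?_
  have h5 : ZMod.stdAddChar (a * (n : ZMod q)) = (ZMod.stdAddChar a : ℂ) ^ n := by
    rw [mul_comm, ← nsmul_eq_mul, AddChar.map_nsmul_eq_pow]
  rw [h5, mul_pow]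
  ring

theorem natCast_mul_eq_neg_sum_log_of_tendsto {q : ℕ} [NeZero q] {χ : DirichletCharacter ℂ q} (hχ : χ ≠ 1)
    {l : ℂ} (hl : Tendsto (fun N : ℕ ↦ ∑ n ∈ Finset.range N, χ (n : ZMod q) / (n : ℂ)) atTop
      (𝓝 l)) :
    (q : ℂ) * l = -∑ a : ZMod q, (∑ m, χ m * ZMod.stdAddChar (-(m * a))) *
      Complex.log (1 - ZMod.stdAddChar a) := by
  have hq : (q : ℂ) ≠ 0 := Nat.cast_ne_zero.2 (NeZero.ne q)
  have hinv : ∀ k, χ k = ∑ a, (q : ℂ)⁻¹ * (∑ m, χ m * ZMod.stdAddChar (-(m * a))) *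
      ZMod.stdAddChar (a * k) := by
    intro k
    have h := congrFun (ZMod.dft.symm_apply_apply (χ : ZMod q → ℂ)) k
    rw [ZMod.invDFT_apply] at h
    simp only [ZMod.dft_apply, smul_eq_mul] at h
    rw [← h, Finset.mul_sum]
    refine Finset.sum_congr rfl fun a _ ↦ ?_
    simp only [mul_comm (χ _)]
    ring
  have h0 : (q : ℂ)⁻¹ * (∑ m, χ m * ZMod.stdAddChar (-(m * (0 : ZMod q)))) = 0 := by
    simp [MulChar.sum_eq_zero_of_ne_one hχ]
  have key := eq_neg_sum_mul_log_of_tendsto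
    (G := fun a ↦ (q : ℂ)⁻¹ * (∑ m, χ m * ZMod.stdAddChar (-(m * a)))) h0 (l := l)
    (by simpa only [← hinv] using hl)
  rw [key, mul_neg, Finset.mul_sum]
  congr 1
  refine Finset.sum_congr rfl fun a _ ↦ ?_
  field_simp

/-- For coprime `q` and `r`, the automorphism of the cyclotomic field of level `q * r` which fixes
the `r`-th roots of unity and raises the `q`-th roots of unity to the power `h`, seen as a pair of
complex embeddings. -/
theorem exists_numberField_algHom_pair {q r : ℕ} [NeZero q] [NeZero r] (hqr : q.Coprime r)
    (h : (ZMod q)ˣ) :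
    ∃ (K : Type) (_ : Field K) (_ : NumberField K) (σ₀ σ : K →ₐ[ℚ] ℂ),
      (∀ z : ℂ, z ^ r = 1 → ∃ x, σ₀ x = z ∧ σ x = z) ∧
      ∀ j : ZMod q, ∃ y, σ₀ y = ZMod.stdAddChar j ∧ σ y = ZMod.stdAddChar ((h : ZMod q) * j) := by
  obtain ⟨n, hnqr⟩ : ∃ n, n = q * r := ⟨_, rfl⟩
  have hn : NeZero n := ⟨hnqr ▸ mul_ne_zero (NeZero.ne q) (NeZero.ne r)⟩
  have hnQ : NeZero (n : ℚ) := ⟨Nat.cast_ne_zero.2 hn.out⟩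
  have hη : IsPrimitiveRoot (Complex.exp (2 * Real.pi * Complex.I / n)) n :=
    Complex.isPrimitiveRoot_exp _ hn.out
  set η : ℂ := Complex.exp (2 * Real.pi * Complex.I / n) with hηdef
  obtain ⟨u, huq, hur⟩ := Nat.chineseRemainder hqr (h : ZMod q).val 1
  have hu : u.Coprime n := by
    rw [hnqr]
    refine Nat.Coprime.mul_right ?_ ?_
    · rw [Nat.coprime_iff_gcd_eq_one, huq.gcd_eq]
      exact ZMod.val_coe_unit_coprime h
    · rw [Nat.coprime_iff_gcd_eq_one, hur.gcd_eq, Nat.gcd_one_left]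
  have huh : (u : ZMod q) = h := by
    rw [(ZMod.natCast_eq_natCast_iff _ _ _).2 huq, ZMod.natCast_zmod_val]
  have hcyc : IsCyclotomicExtension {n} ℚ (CyclotomicField n ℚ) :=
    CyclotomicField.isCyclotomicExtension n ℚ
  have hζ := IsCyclotomicExtension.zeta_spec n ℚ (CyclotomicField n ℚ)
  set ζ := IsCyclotomicExtension.zeta n ℚ (CyclotomicField n ℚ)
  have hembed : ∀ w : ℂ, IsPrimitiveRoot w n →
      ∃ σ : CyclotomicField n ℚ →ₐ[ℚ] ℂ, σ ζ = w := by
    intro w hw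
    let e := hζ.embeddingsEquivPrimitiveRoots ℂ (Polynomial.cyclotomic.irreducible_rat hn.pos)
    refine ⟨e.symm ⟨w, (mem_primitiveRoots hn.pos).2 hw⟩, ?_⟩
    rw [← hζ.embeddingsEquivPrimitiveRoots_apply_coe ℂ
      (Polynomial.cyclotomic.irreducible_rat hn.pos), Equiv.apply_symm_apply]
  obtain ⟨σ₀, hσ₀⟩ := hembed η hη
  obtain ⟨σ, hσ⟩ := hembed (η ^ u) (hη.pow_of_coprime u hu)
  refine ⟨CyclotomicField n ℚ, inferInstance, inferInstance, σ₀, σ, fun z hz ↦ ?_,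
    fun j ↦ ?_⟩
  · obtain ⟨i, -, rfl⟩ := (hη.pow hn.pos hnqr).eq_pow_of_pow_eq_one hz
    refine ⟨(ζ ^ q) ^ i, by simp [hσ₀], ?_⟩
    simp only [map_pow, hσ]
    rw [pow_right_comm η u q, pow_right_comm _ u i]
    rw [pow_eq_pow_mod u hz, hur, ← pow_eq_pow_mod 1 hz, pow_one]
  · have h1 : η ^ r = ZMod.stdAddChar (1 : ZMod q) := by
      have h2 := ZMod.stdAddChar_coe (N := q) 1
      rw [Int.cast_one] at h2
      rw [h2, hηdef, ← Complex.exp_nat_mul, hnqr]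
      congr 1
      have hq : (q : ℂ) ≠ 0 := Nat.cast_ne_zero.2 (NeZero.ne q)
      have hr : (r : ℂ) ≠ 0 := Nat.cast_ne_zero.2 (NeZero.ne r)
      push_cast
      field_simp
    have h2 : ∀ k : ℕ, (η ^ r) ^ k = ZMod.stdAddChar (k : ZMod q) := fun k ↦ by
      rw [h1, ← AddChar.map_nsmul_eq_pow, nsmul_one]
    refine ⟨(ζ ^ r) ^ j.val, ?_, ?_⟩
    · simp only [map_pow, hσ₀, h2, ZMod.natCast_zmod_val]
    · simp only [map_pow, hσ]
      rw [pow_right_comm η u r, ← pow_mul, h2, Nat.cast_mul, ZMod.natCast_zmod_val, huh]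

theorem sum_inv_mul_eq_zero {q : ℕ} [NeZero q] (hcop : q.Coprime q.totient)
    {ι : Type*} [Fintype ι] {χ : ι → DirichletCharacter ℂ q} (hχ : ∀ i, χ i ≠ 1) {l : ι → ℂ}
    (hl : ∀ i, Tendsto (fun N : ℕ ↦ ∑ n ∈ Finset.range N, χ i (n : ZMod q) / (n : ℂ)) atTop
      (𝓝 (l i))) {c : ι → ℚ} (hc : ∑ i, c i * l i = 0) (h : (ZMod q)ˣ) :
    ∑ i, (χ i)⁻¹ h * (c i * l i) = 0 := by
  have hφ : NeZero q.totient := ⟨(Nat.totient_pos.2 (NeZero.pos q)).ne'⟩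
  have hq : (q : ℂ) ≠ 0 := Nat.cast_ne_zero.2 (NeZero.ne q)
  obtain ⟨K, _, _, σ₀, σ, hx, hy⟩ := exists_numberField_algHom_pair hcop h
  have hx' : ∀ i m, ∃ x, σ₀ x = χ i m ∧ σ x = χ i m := by
    intro i m
    by_cases hm : IsUnit m
    · obtain ⟨m, rfl⟩ := hm
      refine hx _ ?_
      rw [← map_pow, ← Units.val_pow_eq_pow_val, ZMod.pow_totient, Units.val_one, map_one]
    · exact ⟨0, by simp [MulChar.map_nonunit _ hm]⟩
  choose X hX₀ hX using hx'
  choose Y hY₀ hY using hy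
  let β : ZMod q → K := fun a ↦ ∑ i, algebraMap ℚ K (c i) * ∑ m, X i m * Y (-(m * a))
  have halg : ∀ a : ZMod q, IsAlgebraic ℚ (Complex.exp (Complex.log (1 - ZMod.stdAddChar a))) := by
    intro a
    rcases eq_or_ne a 0 with rfl | ha
    · simpa using isAlgebraic_one
    · rw [Complex.exp_log]
      · obtain ⟨y, hy⟩ : ∃ y, σ₀ y = 1 - ZMod.stdAddChar a := ⟨1 - Y a, by simp [hY₀]⟩
        rw [← hy]
        exact (Algebra.IsAlgebraic.isAlgebraic y).algHom σ₀
      · exact sub_ne_zero.2 fun hne ↦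
          ha (ZMod.injective_stdAddChar (hne.symm.trans (AddChar.map_zero_eq_one _).symm))
  have hσ₀ : ∑ a, σ₀ (β a) * Complex.log (1 - ZMod.stdAddChar a) = -q * ∑ i, c i * l i := by
    have hterm : ∀ i, -(q : ℂ) * (c i * l i) = ∑ a : ZMod q,
        c i * (∑ m, χ i m * ZMod.stdAddChar (-(m * a))) *
          Complex.log (1 - ZMod.stdAddChar a) := by
      intro i
      simp only [mul_assoc]
      rw [← Finset.mul_sum]
      linear_combination -(c i : ℂ) * natCast_mul_eq_neg_sum_log_of_tendsto (hχ i) (hl i)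
    rw [Finset.mul_sum, Finset.sum_congr rfl fun i _ ↦ hterm i, Finset.sum_comm]
    refine Finset.sum_congr rfl fun a _ ↦ ?_
    simp only [β, map_sum, map_mul, hX₀, hY₀, eq_ratCast, map_ratCast]
    rw [Finset.sum_mul]
  have hσ : ∑ a, σ (β a) * Complex.log (1 - ZMod.stdAddChar a) =
      -q * ∑ i, (χ i)⁻¹ h * (c i * l i) := by
    have hshift : ∀ i a, ∑ m, χ i m * ZMod.stdAddChar ((h : ZMod q) * -(m * a)) =
        (χ i)⁻¹ h * ∑ m, χ i m * (ZMod.stdAddChar (-(m * a)) : ℂ) := by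
      intro i a
      have hinv : (χ i)⁻¹ (h : ZMod q) * χ i h = 1 := by
        rw [← MulChar.mul_apply, inv_mul_cancel, MulChar.one_apply h.isUnit]
      rw [← Equiv.sum_comp h.mulLeft fun m ↦ χ i m * (ZMod.stdAddChar (-(m * a)) : ℂ),
        Finset.mul_sum]
      refine Finset.sum_congr rfl fun m _ ↦ ?_
      simp only [Units.mulLeft_apply, map_mul (χ i), mul_neg, mul_assoc]
      rw [← mul_assoc ((χ i)⁻¹ _), hinv, one_mul]
    have hterm : ∀ i, -(q : ℂ) * ((χ i)⁻¹ h * (c i * l i)) = ∑ a : ZMod q,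
        c i * ((χ i)⁻¹ h * ∑ m, χ i m * ZMod.stdAddChar (-(m * a))) *
          Complex.log (1 - ZMod.stdAddChar a) := by
      intro i
      rw [show -(q : ℂ) * ((χ i)⁻¹ h * (c i * l i)) = c i * (χ i)⁻¹ h * -(q * l i) by ring,
        natCast_mul_eq_neg_sum_log_of_tendsto (hχ i) (hl i), neg_neg, Finset.mul_sum]
      refine Finset.sum_congr rfl fun a _ ↦ ?_
      ring
    rw [Finset.mul_sum, Finset.sum_congr rfl fun i _ ↦ hterm i, Finset.sum_comm]
    refine Finset.sum_congr rfl fun a _ ↦ ?_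
    simp only [β, map_sum, map_mul, hX, hY, eq_ratCast, map_ratCast, hshift]
    rw [Finset.sum_mul]
  have key := sum_algHom_mul_eq_zero _ halg β σ₀ (by rw [hσ₀, hc, mul_zero]) σ
  rw [hσ] at key
  exact (mul_eq_zero.1 key).resolve_left (neg_ne_zero.2 hq)

theorem mul_eq_zero_of_sum_inv_mul_eq_zero {q : ℕ} {ι : Type*} [Fintype ι]
    {χ : ι → DirichletCharacter ℂ q} (hχ : Function.Injective χ) {d : ι → ℂ}
    (hd : ∀ h : (ZMod q)ˣ, ∑ i, (χ i)⁻¹ h * d i = 0) (i : ι) : d i = 0 := by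
  have hinj : Function.Injective fun i ↦ (χ i)⁻¹.toMonoidHom := by
    intro i j hij
    refine hχ (inv_injective (MulChar.ext' fun a ↦ ?_))
    exact DFunLike.congr_fun hij a
  have hli := (linearIndependent_monoidHom (ZMod q) ℂ).comp _ hinj
  have hli' := Fintype.linearIndependent_iff.1 hli d
  refine hli' ?_ i
  ext a
  by_cases ha : IsUnit a
  · obtain ⟨h, rfl⟩ := ha
    simpa [mul_comm] using hd h
  · simp [MulChar.map_nonunit _ ha]

end LSeries

/-- **The Baker–Birch–Wirsing theorem (1973) on a problem of Chowla.**
Let `q ≥ 1` be an integer coprime to its Euler totient `φ(q)`. Then the values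
`L(1, χ) = ∑_{n≥1} χ(n)/n`, as `χ` runs over the non-principal Dirichlet characters
modulo `q`, are linearly independent over `ℚ`. (Here `L χ` is characterised as the
limit of the partial sums of the series.) -/
theorem baker_birch_wirsing (q : ℕ) (hq : 1 ≤ q) (hcop : Nat.Coprime q (Nat.totient q))
    (L : DirichletCharacter ℂ q → ℂ)
    (hL : ∀ χ : DirichletCharacter ℂ q, χ ≠ 1 →
      Filter.Tendsto (fun N : ℕ => ∑ n ∈ Finset.range N, χ (n : ZMod q) / (n : ℂ))
        Filter.atTop (nhds (L χ))) :
    LinearIndependent ℚ (fun χ : {χ : DirichletCharacter ℂ q // χ ≠ 1} => L χ.1) := by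
  classical
  have : NeZero q := ⟨by omega⟩
  have : Fintype {χ : DirichletCharacter ℂ q // χ ≠ 1} := Fintype.ofFinite _
  rw [Fintype.linearIndependent_iff]
  intro c hc χ
  have hc' : ∑ χ : {χ : DirichletCharacter ℂ q // χ ≠ 1}, (c χ : ℂ) * L χ.1 = 0 := by
    simpa only [Rat.smul_def] using hc
  have h1 := mul_eq_zero_of_sum_inv_mul_eq_zero Subtype.val_injective
    (sum_inv_mul_eq_zero hcop (χ := Subtype.val) (l := fun χ ↦ L χ.1) (fun χ ↦ χ.2)
      (fun χ ↦ hL χ.1 χ.2) hc') χ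
  have h2 : L χ.1 ≠ 0 := by
    rw [eq_LFunction_one_of_tendsto χ.2 (hL χ.1 χ.2)]
    exact DirichletCharacter.LFunction_apply_one_ne_zero χ.2
  exact_mod_cast (mul_eq_zero.1 h1).resolve_right h2
end

section
/- Let p and q be coprime rational integers with p > q ≥ 2. Then there exist a real number η < 1 and a real number c > 0 such that for every integer k ≥ 1, the distance from (p/q)^k to the nearest integer satisfies ‖(p/q)^k‖ ≥ c / q^(η·k). -/
/-- The Siegel lemma for the coefficients of a sparse polynomial vanishing to order `M` at `1`. -/
theorem exists_int_vec_sum_choose_eq_zero {ι : Type*} [Fintype ι] {M E : ℕ} (hM : 0 < M)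
    (hcard : Fintype.card ι = 2 * M) (e : ι → ℕ) (he : ∀ i, e i ≤ E) :
    ∃ c : ι → ℤ, c ≠ 0 ∧ (∀ i, |c i| ≤ 2 * M * 2 ^ E) ∧
      ∀ h < M, ∑ i, c i * ((e i).choose h : ℤ) = 0 := by
  classical
  let A : Matrix (Fin M) ι ℤ := Matrix.of fun h i => ((e i).choose h : ℤ)
  obtain ⟨c, hc0, hc, hnorm⟩ := Int.Matrix.exists_ne_zero_int_vec_norm_le A
    (by simp [hcard]; omega) (by simpa using hM)
  refine ⟨c, hc0, fun i => ?_, fun h hh => ?_⟩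
  · let := Matrix.seminormedAddCommGroup (m := Fin M) (n := ι) (α := ℤ)
    have hA : ‖A‖ ≤ (2 : ℝ) ^ E := by
      rw [Matrix.norm_le_iff (by positivity)]
      intro h i
      simp only [A, Matrix.of_apply, Int.norm_eq_abs, Int.cast_natCast, Nat.abs_cast]
      have h1 := Nat.choose_le_two_pow (e i) h
      have h2 : 2 ^ e i ≤ 2 ^ E := Nat.pow_le_pow_right (by norm_num) (he i)
      exact_mod_cast h1.trans h2
    have h1 : ‖c i‖ ≤ ‖c‖ := norm_le_pi_norm c i
    have hexp : ((Fintype.card (Fin M) : ℝ) / (Fintype.card ι - Fintype.card (Fin M))) = 1 := by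
      rw [hcard, Fintype.card_fin]
      push_cast
      have : (M : ℝ) ≠ 0 := by positivity
      field_simp
      ring
    rw [hexp, Real.rpow_one, hcard] at hnorm
    have h2 : max 1 ‖A‖ ≤ (2 : ℝ) ^ E := max_le (one_le_pow₀ (by norm_num)) hA
    have h3 : ‖c i‖ ≤ 2 * M * 2 ^ E := by
      refine (h1.trans hnorm).trans ?_
      push_cast
      gcongr
    rw [Int.norm_eq_abs] at h3
    exact_mod_cast h3
  · have := congrFun hc ⟨h, hh⟩
    simp only [Matrix.mulVec, dotProduct, A, Matrix.of_apply, Pi.zero_apply] at this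
    rw [← this]
    exact Finset.sum_congr rfl fun i _ => mul_comm _ _

open Polynomial in
theorem sum_mul_eval_eq_zero {ι : Type*} [Fintype ι] {M : ℕ} (e : ι → ℕ) (c : ι → ℤ)
    (hc : ∀ h < M, ∑ i, c i * ((e i).choose h : ℤ) = 0) (P : ℚ[X]) (hP : P.degree < M) :
    ∑ i, (c i : ℚ) * P.eval (e i : ℚ) = 0 := by
  induction M generalizing P with
  | zero =>
    have : P = 0 := by
      rw [← Polynomial.degree_eq_bot]
      simpa using hP
    simp [this]
  | succ M ih =>
    have ih' := ih fun h hh => hc h (hh.trans (Nat.lt_succ_self M))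
    have hD : ∑ i, (c i : ℚ) * (descPochhammer ℚ M).eval (e i : ℚ) = 0 := by
      have h1 := hc M (Nat.lt_succ_self M)
      have h2 : ∑ i, (c i : ℚ) * ((e i).choose M : ℚ) = 0 := by exact_mod_cast h1
      calc ∑ i, (c i : ℚ) * (descPochhammer ℚ M).eval (e i : ℚ)
          = ∑ i, (M.factorial : ℚ) * ((c i : ℚ) * ((e i).choose M : ℚ)) := by
            refine Finset.sum_congr rfl fun i _ => ?_
            rw [descPochhammer_eval_eq_descFactorial, Nat.descFactorial_eq_factorial_mul_choose]
            push_cast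
            ring
        _ = 0 := by rw [← Finset.mul_sum, h2, mul_zero]
    have hmon : (descPochhammer ℚ M).Monic := monic_descPochhammer ℚ M
    have hdeg : (descPochhammer ℚ M).natDegree = M := descPochhammer_natDegree ℚ M
    have hQ : (P - C (P.coeff M) * descPochhammer ℚ M).degree < M := by
      rw [Polynomial.degree_lt_iff_coeff_zero]
      intro m hm
      rcases hm.eq_or_lt with rfl | hm
      · have : (descPochhammer ℚ M).coeff M = 1 := by
          have := hmon.coeff_natDegree
          rwa [hdeg] at this
        simp [this]
      · have h1 : P.coeff m = 0 := by
          rw [Polynomial.degree_lt_iff_coeff_zero] at hP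
          exact hP m hm
        have h2 : (descPochhammer ℚ M).coeff m = 0 :=
          Polynomial.coeff_eq_zero_of_natDegree_lt (by omega)
        simp [h1, h2]
    have h3 := ih' _ hQ
    simp only [eval_sub, eval_mul, eval_C, mul_sub, Finset.sum_sub_distrib] at h3
    have h4 : ∑ i, (c i : ℚ) * (P.coeff M * (descPochhammer ℚ M).eval (e i : ℚ)) = 0 := by
      calc _ = P.coeff M * ∑ i, (c i : ℚ) * (descPochhammer ℚ M).eval (e i : ℚ) := by
            rw [Finset.mul_sum]
            exact Finset.sum_congr rfl fun i _ => by ring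
        _ = 0 := by rw [hD, mul_zero]
    rw [h4, sub_zero] at h3
    exact h3

open Polynomial in
/-- An integer-valued polynomial of degree at most `κ` whose integer zeros are `β, …, β + κ - 1`. -/
theorem exists_window_polynomial (κ : ℕ) (β : ℤ) :
    ∃ (g : ℤ → ℤ) (P : ℚ[X]), P.natDegree ≤ κ ∧ (∀ x : ℤ, P.eval (x : ℚ) = g x) ∧
      (∀ x, g x = 0 ↔ β ≤ x ∧ x < β + κ) ∧ ∀ x, |g x| ≤ 2 ^ ((x - β).natAbs + κ) := by
  have key : ∀ y : ℤ, (∃ z : ℕ, y = z ∧ Ring.choose y κ = (z.choose κ : ℤ)) ∨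
      (∃ z : ℕ, y = -(z + 1 : ℤ) ∧ |Ring.choose y κ| = ((z + κ).choose κ : ℤ)) := by
    intro y
    rcases y with z | z
    · left
      refine ⟨z, rfl, ?_⟩
      exact Ring.choose_natCast (R := ℤ) z κ
    · right
      refine ⟨z, by rw [Int.negSucc_eq], ?_⟩
      rw [Int.negSucc_eq, Ring.choose_neg]
      have : ((z : ℤ) + 1 + κ - 1) = ((z + κ : ℕ) : ℤ) := by push_cast; ring
      rw [this, Ring.choose_natCast]
      rw [Units.smul_def, smul_eq_mul, abs_mul, Int.isUnit_iff_abs_eq.mp (Units.isUnit _), one_mul,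
        Nat.abs_cast]
  refine ⟨fun x => Ring.choose (x - β) κ,
    C ((κ.factorial : ℚ)⁻¹) * (descPochhammer ℚ κ).comp (X - C (β : ℚ)), ?_, ?_, ?_, ?_⟩
  · refine (natDegree_C_mul_le _ _).trans ?_
    rw [natDegree_comp, natDegree_X_sub_C, mul_one, descPochhammer_natDegree]
  · intro x
    have h := Ring.descPochhammer_eq_factorial_smul_choose (x - β) κ
    have h2 : (descPochhammer ℚ κ).eval ((x : ℚ) - β) = κ.factorial * (Ring.choose (x - β) κ : ℤ) := by
      have h3 : ((descPochhammer ℤ κ).eval (x - β) : ℤ) = κ.factorial * Ring.choose (x - β) κ := by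
        rw [← Polynomial.eval_eq_smeval] at h
        rw [h, nsmul_eq_mul]
      have h4 := congrArg (Int.cast : ℤ → ℚ) h3
      push_cast at h4
      rw [← h4]
    simp only [eval_mul, eval_C, eval_comp, eval_sub, eval_X]
    rw [h2]
    field_simp
  · intro x
    rcases key (x - β) with ⟨z, hz, h⟩ | ⟨z, hz, h⟩
    · simp only [h]
      rw [Int.natCast_eq_zero, Nat.choose_eq_zero_iff]
      omega
    · have : Ring.choose (x - β) κ ≠ 0 := by
        rw [← abs_pos, h]
        exact_mod_cast Nat.choose_pos (by omega)
      simp only [this, false_iff]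
      omega
  · intro x
    rcases key (x - β) with ⟨z, hz, h⟩ | ⟨z, hz, h⟩
    · simp only [h]
      rw [abs_of_nonneg (by positivity)]
      have h1 : z.choose κ ≤ 2 ^ z := Nat.choose_le_two_pow _ _
      have h2 : 2 ^ z ≤ 2 ^ ((x - β).natAbs + κ) := Nat.pow_le_pow_right (by norm_num) (by omega)
      exact_mod_cast h1.trans h2
    · simp only [h]
      have h1 : (z + κ).choose κ ≤ 2 ^ (z + κ) := Nat.choose_le_two_pow _ _
      have h2 : 2 ^ (z + κ) ≤ 2 ^ ((x - β).natAbs + κ) := Nat.pow_le_pow_right (by norm_num) (by omega)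
      exact_mod_cast h1.trans h2

theorem sub_pow_dvd_sum {ι : Type*} [Fintype ι] {M D : ℕ} (e : ι → ℕ) (he : ∀ i, e i ≤ D)
    (d : ι → ℤ) (hd : ∀ h < M, ∑ i, d i * ((e i).choose h : ℤ) = 0) (X Y : ℤ) :
    (X - Y) ^ M ∣ ∑ i, d i * (X ^ e i * Y ^ (D - e i)) := by
  have h1 : ∀ i, X ^ e i * Y ^ (D - e i) =
      ∑ h ∈ Finset.range (D + 1), (X - Y) ^ h * Y ^ (D - h) * ((e i).choose h : ℤ) := by
    intro i
    have h2 : X ^ e i = ∑ h ∈ Finset.range (e i + 1),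
        (X - Y) ^ h * Y ^ (e i - h) * ((e i).choose h : ℤ) := by
      rw [← add_pow, sub_add_cancel]
    rw [h2, Finset.sum_mul]
    have hs : Finset.range (e i + 1) ⊆ Finset.range (D + 1) :=
      Finset.range_mono (Nat.add_le_add_right (he i) 1)
    rw [← Finset.sum_subset hs]
    · refine Finset.sum_congr rfl fun h hh => ?_
      have hh' : h ≤ e i := Nat.lt_succ_iff.mp (Finset.mem_range.mp hh)
      have := he i
      rw [show D - h = (e i - h) + (D - e i) by omega, pow_add]
      ring
    · intro h _ hh
      rw [Nat.choose_eq_zero_of_lt (by simpa using hh)]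
      simp
  simp_rw [h1, Finset.mul_sum]
  rw [Finset.sum_comm]
  refine Finset.dvd_sum fun h _ => ?_
  have h3 : ∑ i, d i * ((X - Y) ^ h * Y ^ (D - h) * ((e i).choose h : ℤ)) =
      (X - Y) ^ h * (Y ^ (D - h) * ∑ i, d i * ((e i).choose h : ℤ)) := by
    simp_rw [Finset.mul_sum]
    exact Finset.sum_congr rfl fun i _ => by ring
  rw [h3]
  by_cases hh : h < M
  · simp [hd h hh]
  · exact Dvd.dvd.mul_right (pow_dvd_pow _ (by omega)) _

/-- In each block `j`, all monomials comparable in size with the largest one (other than the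
largest itself) have exponents in a window of length `t`. -/
theorem exists_dominance_window {a t L n : ℕ} {X Y V R : ℤ} (ht : 0 < t) (hY : Y ≠ 0)
    (hV : V ≠ 0) (hXY : |Y| < X) (hR : |Y| ^ t * R ≤ X ^ t) (w : Fin a × Fin L → ℤ)
    (hw : ∀ x, w x = X ^ (x.1 : ℕ) * |Y| ^ (a - x.1) * (|V| ^ (x.2 : ℕ) * |Y| ^ (n * (L - x.2))))
    (S : Fin a × Fin L → Prop) (top : Fin a × Fin L) (hmax : ∀ x, S x → w x ≤ w top)
    (j : Fin L) :
    ∃ b : ℤ, -t ≤ b ∧ b ≤ a ∧ (∀ i : Fin a, S (i, j) → (i, j) ≠ top →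
      (b ≤ i ∧ (i : ℤ) < b + t) ∨ R * w (i, j) ≤ w top) ∧ (j = top.2 → (top.1 : ℤ) = b + t) := by
  have hY' : 0 < |Y| := abs_pos.mpr hY
  have hV' : 0 < |V| := abs_pos.mpr hV
  have hX : 0 < X := hY'.trans hXY
  have hwpos : ∀ x, 0 < w x := fun x => by rw [hw]; positivity
  have hmul : ∀ (i i' : Fin a) (j : Fin L), i ≤ i' →
      w (i', j) * |Y| ^ ((i' : ℕ) - i) = w (i, j) * X ^ ((i' : ℕ) - i) := by
    intro i i' j hii
    have h1 : (i : ℕ) ≤ i' := hii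
    have h2 := i'.isLt
    have e1 : X ^ (i' : ℕ) = X ^ (i : ℕ) * X ^ ((i' : ℕ) - i) := by
      rw [← pow_add]; congr 1; omega
    have e2 : |Y| ^ (a - (i : ℕ)) = |Y| ^ (a - (i' : ℕ)) * |Y| ^ ((i' : ℕ) - i) := by
      rw [← pow_add]; congr 1; omega
    rw [hw, hw]
    simp only [e1, e2]
    ring
  have hstrict : ∀ (i i' : Fin a) (j : Fin L), i < i' → w (i, j) < w (i', j) := by
    intro i i' j hii
    have h1 : (i' : ℕ) - i ≠ 0 := by have : (i : ℕ) < i' := hii; omega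
    have h2 : |Y| ^ ((i' : ℕ) - i) < X ^ ((i' : ℕ) - i) := pow_lt_pow_left₀ hXY hY'.le h1
    have h3 := hmul i i' j hii.le
    by_contra hcon
    push Not at hcon
    have h4 : w (i', j) * |Y| ^ ((i' : ℕ) - i) < w (i, j) * X ^ ((i' : ℕ) - i) :=
      mul_lt_mul' hcon h2 (by positivity) (hwpos _)
    exact absurd h3 h4.ne
  have hgap : ∀ (i i' : Fin a) (j : Fin L), (i : ℕ) + t ≤ i' → R * w (i, j) ≤ w (i', j) := by
    intro i i' j hii
    have h3 := hmul i i' j (by rw [Fin.le_def]; omega)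
    have h5 : |Y| ^ ((i' : ℕ) - i) * R ≤ X ^ ((i' : ℕ) - i) := by
      have : (i' : ℕ) - i = t + ((i' : ℕ) - i - t) := by omega
      rw [this, pow_add, pow_add]
      calc |Y| ^ t * |Y| ^ ((i' : ℕ) - i - t) * R
          = (|Y| ^ t * R) * |Y| ^ ((i' : ℕ) - i - t) := by ring
        _ ≤ X ^ t * |Y| ^ ((i' : ℕ) - i - t) := by gcongr
        _ ≤ X ^ t * X ^ ((i' : ℕ) - i - t) := by gcongr
    refine le_of_mul_le_mul_right ?_ (pow_pos hY' ((i' : ℕ) - i))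
    rw [h3]
    calc R * w (i, j) * |Y| ^ ((i' : ℕ) - i) = w (i, j) * (|Y| ^ ((i' : ℕ) - i) * R) := by ring
      _ ≤ w (i, j) * X ^ ((i' : ℕ) - i) := mul_le_mul_of_nonneg_left h5 (hwpos _).le
  by_cases hj : j = top.2
  · subst hj
    have h1 := top.1.isLt
    refine ⟨(top.1 : ℤ) - t, by omega, by omega, fun i hS hne => ?_, fun _ => by ring⟩
    rcases lt_trichotomy i top.1 with h | h | h
    · have h' : (i : ℕ) < top.1 := h
      by_cases hi : (i : ℕ) + t ≤ top.1
      · right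
        exact hgap i top.1 top.2 hi
      · left
        omega
    · exact absurd (by rw [h]) hne
    · exact absurd (hmax _ hS) (not_le.mpr (hstrict top.1 i top.2 h))
  · by_cases hex : ∃ l : ℕ, ∃ h : l < a, w top < R * w (⟨l, h⟩, j)
    · classical
      obtain ⟨hl, hlt⟩ := Nat.find_spec hex
      have hmin := fun m (hm : m < Nat.find hex) => Nat.find_min hex hm
      set l := Nat.find hex
      refine ⟨l, by omega, by omega, fun i hS _ => ?_, fun h => absurd h hj⟩
      by_cases h1 : (i : ℕ) < l
      · right
        have := hmin i h1
        push Not at this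
        exact this i.isLt
      · left
        refine ⟨by omega, ?_⟩
        by_contra h2
        have h3 := hgap ⟨l, hl⟩ i j (by simp only; omega)
        exact absurd (hmax _ hS) (not_le.mpr (hlt.trans_le h3))
    · push Not at hex
      exact ⟨0, by omega, by omega, fun i _ _ => Or.inr (hex i i.isLt), fun h => absurd h hj⟩

open Polynomial in
/-- A nonzero integer of controlled size, obtained by specializing a polynomial `F(x, x ^ n)` with
high vanishing order at `x = 1`, divisible by every common divisor of `X ^ n - V` and a high power
of `X - Y`. -/
theorem exists_auxiliary_integer {t L n : ℕ} {X Y V R : ℤ} (ht : 0 < t) (hL : 0 < L)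
    (hn : 6 * t ≤ n) (hY : Y ≠ 0) (hV : V ≠ 0) (hXY : |Y| < X)
    (hRdef : R = 2 * (4 * t * L) ^ 2 * 2 ^ (4 * t + n * L) * 2 ^ (L * (4 * t + n * L + 2 * t)))
    (hR : |Y| ^ t * R ≤ X ^ t) :
    ∃ G : ℤ, G ≠ 0 ∧ |G| ≤ R * (X ^ (4 * t) * max |V| (|Y| ^ n) ^ L) ∧
      ∀ Q : ℤ, Q ∣ X ^ n - V → Q ∣ (X - Y) ^ (t * L) → Q ∣ G := by
  classical
  set E := 4 * t + n * L with hE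
  have hY' : 0 < |Y| := abs_pos.mpr hY
  have hV' : 0 < |V| := abs_pos.mpr hV
  have hX : 0 < X := hY'.trans hXY
  let e : Fin (4 * t) × Fin L → ℕ := fun x => x.1 + n * x.2
  have he : ∀ x, e x ≤ E := fun x => by
    have h1 := x.1.isLt
    have h2 : n * (x.2 : ℕ) ≤ n * L := Nat.mul_le_mul_left _ x.2.isLt.le
    simp only [e]
    omega
  obtain ⟨c, hc0, hcB, hc⟩ := exists_int_vec_sum_choose_eq_zero (M := 2 * t * L) (E := E)
    (by positivity) (by simp; ring) e he
  let μ : Fin (4 * t) × Fin L → ℤ := fun x =>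
    X ^ (x.1 : ℕ) * Y ^ (4 * t - x.1) * (V ^ (x.2 : ℕ) * Y ^ (n * (L - x.2)))
  let w : Fin (4 * t) × Fin L → ℤ := fun x => |μ x|
  have hw : ∀ x, w x = X ^ (x.1 : ℕ) * |Y| ^ (4 * t - x.1) *
      (|V| ^ (x.2 : ℕ) * |Y| ^ (n * (L - x.2))) := by
    intro x
    simp only [w, μ, abs_mul, abs_pow, abs_of_pos hX]
  have hwpos : ∀ x, 0 < w x := fun x => by rw [hw]; positivity
  obtain ⟨top, htop, hmax⟩ : ∃ top, c top ≠ 0 ∧ ∀ x, c x ≠ 0 → w x ≤ w top := by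
    have hne : (Finset.univ.filter fun x => c x ≠ 0).Nonempty := by
      obtain ⟨x, hx⟩ := Function.ne_iff.mp hc0
      exact ⟨x, by simpa using hx⟩
    obtain ⟨top, h1, h2⟩ := Finset.exists_max_image _ w hne
    exact ⟨top, by simpa using h1, fun x hx => h2 x (by simpa using hx)⟩
  choose b hb1 hb2 hb3 hb4 using
    exists_dominance_window ht hY hV hXY hR w hw (fun x => c x ≠ 0) top hmax
  choose g P hP1 hP2 hg0 hgB using fun j : Fin L => exists_window_polynomial t (n * j + b j)
  let γ : ℤ → ℤ := fun x => ∏ j, g j x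
  have hγB : ∀ x, |γ (e x)| ≤ 2 ^ (L * (E + 2 * t)) := by
    intro x
    simp only [γ, Finset.abs_prod]
    calc ∏ j, |g j (e x)| ≤ ∏ _j : Fin L, (2 : ℤ) ^ (E + 2 * t) := by
          refine Finset.prod_le_prod (fun _ _ => abs_nonneg _) fun j _ => (hgB j _).trans ?_
          refine pow_le_pow_right₀ (by norm_num) ?_
          have h1 := he x
          have h2 := hb1 j
          have h3 := hb2 j
          have h4 : n * ((j : ℕ) + 1) ≤ n * L := Nat.mul_le_mul_left _ j.isLt
          have h5 : ((e x : ℤ) - (n * j + b j)).natAbs ≤ E + t := by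
            have h6 : ((n * (j : ℕ) : ℕ) : ℤ) = n * j := by push_cast; ring
            rw [← h6]
            rw [mul_add, mul_one] at h4
            omega
          omega
      _ = 2 ^ (L * (E + 2 * t)) := by simp [← pow_mul, mul_comm]
  have hγtop : γ (e top) ≠ 0 := by
    simp only [γ]
    rw [Finset.prod_ne_zero_iff]
    intro j _ h0
    rw [hg0] at h0
    have h1 := hb1 j
    have h2 := hb2 j
    have h3 := top.1.isLt
    obtain ⟨h4, h5⟩ := h0
    simp only [e] at h4 h5
    push_cast at h4 h5
    rcases lt_trichotomy j top.2 with h | h | h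
    · have h6 : n * ((j : ℕ) + 1) ≤ n * (top.2 : ℕ) := Nat.mul_le_mul_left _ h
      zify at h6 hn h3
      rw [mul_add, mul_one] at h6
      push_cast at h2
      linarith
    · have h6 := hb4 j h
      rw [h] at h4 h5 h6
      linarith
    · have h6 : n * ((top.2 : ℕ) + 1) ≤ n * (j : ℕ) := Nat.mul_le_mul_left _ h
      zify at h6 hn h3
      rw [mul_add, mul_one] at h6
      linarith
  have hkill : ∀ x, c x ≠ 0 → x ≠ top → R * w x ≤ w top ∨ γ (e x) = 0 := by
    intro x hx hne
    rcases hb3 x.2 x.1 hx hne with h | h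
    · right
      simp only [γ]
      refine Finset.prod_eq_zero (Finset.mem_univ x.2) ?_
      rw [hg0]
      simp only [e]
      push_cast
      constructor <;> linarith [h.1, h.2]
    · exact Or.inl h
  set B : ℤ := 2 * (2 * t * L : ℕ) * 2 ^ E with hB
  set Γ : ℤ := 2 ^ (L * (E + 2 * t)) with hΓ
  have hRB : R = 2 * (4 * t * L) * (B * Γ) := by
    rw [hRdef, hB, hΓ]; push_cast; ring
  have hcard : (Fintype.card (Fin (4 * t) × Fin L) : ℤ) = 4 * t * L := by simp
  have hterm : ∀ x, |c x * γ (e x)| ≤ B * Γ := fun x => by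
    rw [abs_mul]
    exact mul_le_mul (hcB x) (hγB x) (abs_nonneg _) (by positivity)
  have hBΓ : 0 < B * Γ := by positivity
  refine ⟨∑ x, c x * γ (e x) * μ x, ?_, ?_, ?_⟩
  · intro h0
    have h1 : c top * γ (e top) * μ top =
        -∑ x ∈ Finset.univ.erase top, c x * γ (e x) * μ x := by
      rw [← Finset.add_sum_erase _ _ (Finset.mem_univ top)] at h0
      linarith
    have h2 : w top ≤ |c top * γ (e top) * μ top| := by
      rw [abs_mul]
      exact le_mul_of_one_le_left (hwpos _).le (Int.one_le_abs (mul_ne_zero htop hγtop))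
    have h3 : ∀ x ∈ Finset.univ.erase top, 2 * (4 * t * L) * |c x * γ (e x) * μ x| ≤ w top := by
      intro x hx
      by_cases hcx : c x = 0
      · simp [hcx, (hwpos top).le]
      rcases hkill x hcx (Finset.ne_of_mem_erase hx) with h | h
      · refine le_trans ?_ h
        rw [hRB, abs_mul, mul_assoc (2 * (4 * (t : ℤ) * L))]
        have := hterm x
        have := (hwpos x).le
        change 2 * (4 * (t : ℤ) * L) * (|c x * γ (e x)| * w x) ≤ _
        gcongr
      · simp [h, (hwpos top).le]
    have h4 : 2 * (4 * t * L) * w top ≤ (4 * t * L) * w top := by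
      calc 2 * (4 * t * L) * w top ≤ 2 * (4 * t * L) * |c top * γ (e top) * μ top| := by gcongr
        _ ≤ 2 * (4 * t * L) * ∑ x ∈ Finset.univ.erase top, |c x * γ (e x) * μ x| := by
            rw [h1, abs_neg]
            gcongr
            exact Finset.abs_sum_le_sum_abs _ _
        _ ≤ ∑ _x ∈ Finset.univ.erase top, w top := by
            rw [Finset.mul_sum]
            exact Finset.sum_le_sum h3
        _ ≤ ∑ _x : Fin (4 * t) × Fin L, w top :=
            Finset.sum_le_sum_of_subset_of_nonneg (Finset.erase_subset _ _)
              fun _ _ _ => (hwpos _).le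
        _ = (4 * t * L) * w top := by
            rw [Finset.sum_const, Finset.card_univ, nsmul_eq_mul, hcard]
    have h5 : 0 < (4 * (t : ℤ) * L) * w top := mul_pos (by positivity) (hwpos _)
    linarith
  · have hY1 : 1 ≤ |Y| := hY'
    set m := max |V| (|Y| ^ n) with hm
    have hwle : ∀ x, w x ≤ X ^ (4 * t) * m ^ L := by
      intro x
      rw [hw]
      have h1 : X ^ (x.1 : ℕ) * |Y| ^ (4 * t - x.1) ≤ X ^ (4 * t) := by
        calc X ^ (x.1 : ℕ) * |Y| ^ (4 * t - x.1) ≤ X ^ (x.1 : ℕ) * X ^ (4 * t - x.1) := by gcongr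
          _ = X ^ (4 * t) := by rw [← pow_add]; congr 1; have := x.1.isLt; omega
      have h2 : |V| ^ (x.2 : ℕ) * |Y| ^ (n * (L - x.2)) ≤ m ^ L := by
        calc |V| ^ (x.2 : ℕ) * |Y| ^ (n * (L - x.2)) ≤ m ^ (x.2 : ℕ) * m ^ (L - x.2) := by
              rw [pow_mul]
              gcongr
              · exact le_max_left _ _
              · exact le_max_right _ _
          _ = m ^ L := by rw [← pow_add]; congr 1; have := x.2.isLt; omega
      exact mul_le_mul h1 h2 (by positivity) (by positivity)
    have hm0 : 0 ≤ X ^ (4 * t) * m ^ L := by positivity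
    calc |∑ x, c x * γ (e x) * μ x| ≤ ∑ x, |c x * γ (e x) * μ x| := Finset.abs_sum_le_sum_abs _ _
      _ ≤ ∑ _x : Fin (4 * t) × Fin L, (B * Γ) * (X ^ (4 * t) * m ^ L) := by
          refine Finset.sum_le_sum fun x _ => ?_
          rw [abs_mul]
          exact mul_le_mul (hterm x) (hwle x) (abs_nonneg _) hBΓ.le
      _ = (4 * t * L) * (B * Γ) * (X ^ (4 * t) * m ^ L) := by
          rw [Finset.sum_const, Finset.card_univ, nsmul_eq_mul, hcard]
          ring
      _ ≤ R * (X ^ (4 * t) * m ^ L) := by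
          refine mul_le_mul_of_nonneg_right ?_ hm0
          rw [hRB]
          have : 0 ≤ (4 * (t : ℤ) * L) * (B * Γ) := by positivity
          linarith
  · intro Q hQ1 hQ2
    have hΦ : (X - Y) ^ (t * L) ∣ ∑ x, c x * γ (e x) * (X ^ e x * Y ^ (E - e x)) := by
      refine sub_pow_dvd_sum e he _ (fun h hh => ?_) X Y
      have h1 := sum_mul_eval_eq_zero e c hc
        ((∏ j, P j) * (C ((h.factorial : ℚ)⁻¹) * descPochhammer ℚ h)) ?_
      · have h2 : ∀ x, (c x : ℚ) * (((∏ j, P j) *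
            (C ((h.factorial : ℚ)⁻¹) * descPochhammer ℚ h)).eval (e x : ℚ)) =
            ((c x * γ (e x) * ((e x).choose h : ℤ) : ℤ) : ℚ) := by
          intro x
          have h3 : ∀ j, (P j).eval (e x : ℚ) = g j (e x) := fun j => by
            have := hP2 j (e x)
            simpa using this
          rw [eval_mul, eval_prod, eval_mul, eval_C, descPochhammer_eval_eq_descFactorial,
            Nat.descFactorial_eq_factorial_mul_choose]
          simp only [h3, γ]
          push_cast
          field_simp
        simp_rw [h2] at h1
        exact_mod_cast h1
      · refine Polynomial.degree_le_natDegree.trans_lt ?_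
        have h3 : (∏ j, P j).natDegree ≤ L * t := by
          refine (natDegree_prod_le _ _).trans ?_
          refine (Finset.sum_le_card_nsmul _ _ t fun j _ => hP1 j).trans ?_
          simp
        have h4 : (C ((h.factorial : ℚ)⁻¹) * descPochhammer ℚ h).natDegree ≤ h :=
          (natDegree_C_mul_le _ _).trans (descPochhammer_natDegree ℚ h).le
        have h5 := natDegree_mul_le (p := ∏ j, P j)
          (q := C ((h.factorial : ℚ)⁻¹) * descPochhammer ℚ h)
        have h6 : L * t = t * L := mul_comm _ _
        have h7 : 2 * t * L = 2 * (t * L) := by ring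
        norm_cast
        omega
    have hdiff : Q ∣ ∑ x, c x * γ (e x) * (X ^ e x * Y ^ (E - e x)) - ∑ x, c x * γ (e x) * μ x := by
      rw [← Finset.sum_sub_distrib]
      refine Finset.dvd_sum fun x _ => ?_
      have h1 : X ^ e x * Y ^ (E - e x) =
          X ^ (x.1 : ℕ) * Y ^ (4 * t - x.1) * ((X ^ n) ^ (x.2 : ℕ) * Y ^ (n * (L - x.2))) := by
        have h2 := x.1.isLt
        have h3 : n * (x.2 : ℕ) + n * (L - x.2) = n * L := by
          rw [← mul_add]; congr 1; have := x.2.isLt; omega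
        have h4 : E - e x = (4 * t - x.1) + n * (L - x.2) := by
          simp only [e]; omega
        rw [h4]
        simp only [e]
        ring
      have h2 : c x * γ (e x) * (X ^ e x * Y ^ (E - e x)) - c x * γ (e x) * μ x =
          ((X ^ n) ^ (x.2 : ℕ) - V ^ (x.2 : ℕ)) *
            (c x * γ (e x) * (X ^ (x.1 : ℕ) * Y ^ (4 * t - x.1) * Y ^ (n * (L - x.2)))) := by
        rw [h1]; simp only [μ]; ring
      rw [h2]
      exact Dvd.dvd.mul_right (hQ1.trans (sub_dvd_pow_sub_pow _ _ _)) _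
    exact (dvd_iff_dvd_of_dvd_sub hdiff).mp (hQ2.trans hΦ)

theorem auxiliary_constant_le {t L : ℕ} (ht : 0 < t) (hL : 16 ≤ L) :
    (2 * (4 * t * L) ^ 2 * 2 ^ (4 * t + 2 * L * t * L) *
      2 ^ (L * (4 * t + 2 * L * t * L + 2 * t)) : ℤ) ≤ 2 ^ (4 * L ^ 3 * t) := by
  have h1 : (4 * t * L : ℤ) ≤ 2 ^ (4 * t * L) := by
    have := (Nat.lt_two_pow_self (n := 4 * t * L)).le
    exact_mod_cast this
  have h2 : 1 + 14 * (t * L) + 4 * t + 2 * L ^ 2 * t ≤ 2 * L ^ 3 * t := by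
    have h3 : 1 + 14 * L + 4 + 2 * L ^ 2 ≤ 2 * L ^ 3 := by nlinarith
    nlinarith
  calc (2 * (4 * t * L) ^ 2 * 2 ^ (4 * t + 2 * L * t * L) *
        2 ^ (L * (4 * t + 2 * L * t * L + 2 * t)) : ℤ)
      ≤ 2 * (2 ^ (4 * t * L)) ^ 2 * 2 ^ (4 * t + 2 * L * t * L) *
        2 ^ (L * (4 * t + 2 * L * t * L + 2 * t)) := by gcongr
    _ = 2 ^ (1 + 14 * (t * L) + 4 * t + 2 * L ^ 2 * t + 2 * L ^ 3 * t) := by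
        rw [← pow_mul, ← pow_succ', ← pow_add, ← pow_add]
        congr 1
        ring
    _ ≤ 2 ^ (4 * L ^ 3 * t) := by
        refine pow_le_pow_right₀ (by norm_num) ?_
        have : 4 * L ^ 3 * t = 2 * L ^ 3 * t + 2 * L ^ 3 * t := by ring
        omega

/-- Two exponents, the second much larger than the first, cannot both have small residues. -/
theorem not_two_small_residues {p q : ℤ} {τ L k₁ k₂ : ℕ} {r₁ r₂ : ℤ} (hq : 2 ≤ q) (hpq : q < p)
    (hτ : p ≤ q ^ τ) (hL : L = 16 * τ) (hk₁ : 8 * L ^ 3 ≤ k₁) (hk₂ : 2 * L * k₁ * L ^ 2 ≤ k₂)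
    (hr₁ : r₁ ≠ 0) (hr₂ : r₂ ≠ 0) (hd₁ : q ^ k₁ ∣ p ^ k₁ - r₁) (hd₂ : q ^ k₂ ∣ p ^ k₂ - r₂)
    (hs₁ : |r₁| ^ (8 * L) ≤ q ^ k₁) : ¬ |r₂| ^ (8 * L) ≤ q ^ k₂ := by
  intro hs₂
  have hτ0 : 0 < τ := by
    rcases Nat.eq_zero_or_pos τ with rfl | h
    · simp at hτ; omega
    · exact h
  have hL16 : 16 ≤ L := by omega
  have hk₁0 : 0 < k₁ := lt_of_lt_of_le (by positivity) hk₁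
  have hD : 0 < 2 * L * k₁ := by positivity
  have hq1 : 1 ≤ q := by omega
  have hq0 : 0 < q := by omega
  have hp0 : 0 < p := by omega
  obtain ⟨t, s, htL, hs, hsum⟩ : ∃ t s : ℕ, L ^ 2 ≤ t ∧ s ≤ 2 * L * k₁ ∧
      k₂ + s = 2 * L * t * k₁ := by
    refine ⟨k₂ / (2 * L * k₁) + 1, 2 * L * k₁ - k₂ % (2 * L * k₁), ?_, Nat.sub_le _ _, ?_⟩
    · have : L ^ 2 ≤ k₂ / (2 * L * k₁) := (Nat.le_div_iff_mul_le hD).mpr (by linarith)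
      omega
    · have h1 := Nat.div_add_mod k₂ (2 * L * k₁)
      have h2 := Nat.mod_lt k₂ hD
      have h3 : 2 * L * (k₂ / (2 * L * k₁) + 1) * k₁ =
          2 * L * k₁ * (k₂ / (2 * L * k₁)) + 2 * L * k₁ := by ring
      omega
  have ht2 : 2 ≤ t := le_trans (by nlinarith) htL
  have hr₁1 : 1 ≤ |r₁| := Int.one_le_abs hr₁
  have hr₁X : |r₁| < p ^ k₁ := by
    calc |r₁| ≤ |r₁| ^ (8 * L) := le_self_pow₀ hr₁1 (by omega)
      _ ≤ q ^ k₁ := hs₁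
      _ < p ^ k₁ := pow_lt_pow_left₀ hpq hq0.le (by omega)
  have hV : p ^ s * r₂ ≠ 0 := mul_ne_zero (by positivity) hr₂
  set R : ℤ := 2 * (4 * t * L) ^ 2 * 2 ^ (4 * t + 2 * L * t * L) *
      2 ^ (L * (4 * t + 2 * L * t * L + 2 * t)) with hRdef
  have hRq : R ≤ q ^ (4 * L ^ 3 * t) :=
    (auxiliary_constant_le (by omega) hL16).trans (pow_le_pow_left₀ (by norm_num) hq _)
  have hRτ : R ≤ q ^ (τ * t * k₁) := by
    refine hRq.trans (pow_le_pow_right₀ hq1 ?_)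
    calc 4 * L ^ 3 * t ≤ k₁ * t := Nat.mul_le_mul_right _ (by omega)
      _ ≤ τ * (k₁ * t) := Nat.le_mul_of_pos_left _ hτ0
      _ = τ * t * k₁ := by ring
  have hgap : |r₁| ^ t * R ≤ (p ^ k₁) ^ t := by
    have h1 : |r₁| * q ^ (4 * L ^ 3) ≤ q ^ k₁ := by
      refine le_of_pow_le_pow_left₀ (n := 2) (by norm_num) (by positivity) ?_
      calc (|r₁| * q ^ (4 * L ^ 3)) ^ 2 = |r₁| ^ 2 * q ^ (8 * L ^ 3) := by
            rw [mul_pow, ← pow_mul]; congr 2; ring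
        _ ≤ q ^ k₁ * q ^ k₁ := by
            gcongr
            exact (pow_le_pow_right₀ hr₁1 (by omega)).trans hs₁
        _ = (q ^ k₁) ^ 2 := by ring
    calc |r₁| ^ t * R ≤ |r₁| ^ t * q ^ (4 * L ^ 3 * t) := by gcongr
      _ = (|r₁| * q ^ (4 * L ^ 3)) ^ t := by rw [mul_pow, ← pow_mul]
      _ ≤ (p ^ k₁) ^ t := by
          gcongr
          exact h1.trans (pow_le_pow_left₀ hq0.le hpq.le _)
  obtain ⟨G, hG0, hGle, hGd⟩ := exists_auxiliary_integer (n := 2 * L * t) (L := L) (t := t)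
    (by omega) (by omega) (by nlinarith) hr₁ hV hr₁X hRdef hgap
  have hQG : q ^ (k₁ * (t * L)) ∣ G := by
    refine hGd _ ?_ ?_
    · have h1 : (p ^ k₁) ^ (2 * L * t) - p ^ s * r₂ = p ^ s * (p ^ k₂ - r₂) := by
        rw [← pow_mul, show k₁ * (2 * L * t) = s + k₂ by rw [add_comm, hsum]; ring, pow_add]
        ring
      rw [h1]
      refine Dvd.dvd.mul_left ((pow_dvd_pow q ?_).trans hd₂) _
      have h2 : k₁ * (t * L) * 2 = 2 * L * t * k₁ := by ring
      have h3 : 2 * L * k₁ ≤ k₁ * (t * L) := by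
        calc 2 * L * k₁ ≤ t * L * k₁ := by gcongr
          _ = k₁ * (t * L) := by ring
      omega
    · rw [pow_mul]
      exact pow_dvd_pow_of_dvd hd₁ _
  have hX4 : (p ^ k₁) ^ (4 * t) ≤ q ^ (4 * τ * t * k₁) := by
    calc (p ^ k₁) ^ (4 * t) ≤ ((q ^ τ) ^ k₁) ^ (4 * t) := by gcongr
      _ = q ^ (4 * τ * t * k₁) := by rw [← pow_mul, ← pow_mul]; congr 1; ring
  have hmax : max |p ^ s * r₂| (|r₁| ^ (2 * L * t)) ^ L ≤ q ^ (6 * τ * t * k₁) := by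
    rcases max_choice |p ^ s * r₂| (|r₁| ^ (2 * L * t)) with h | h <;> rw [h]
    · refine le_of_pow_le_pow_left₀ (n := 8) (by norm_num) (by positivity) ?_
      calc (|p ^ s * r₂| ^ L) ^ 8 = (p ^ s) ^ (8 * L) * |r₂| ^ (8 * L) := by
            rw [abs_mul, abs_of_pos (by positivity : 0 < p ^ s), ← pow_mul, mul_pow, mul_comm L 8]
        _ ≤ ((q ^ τ) ^ s) ^ (8 * L) * q ^ k₂ := by gcongr
        _ = q ^ (τ * s * (8 * L) + k₂) := by rw [← pow_mul, ← pow_mul, ← pow_add, mul_assoc τ]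
        _ ≤ q ^ (6 * τ * t * k₁ * 8) := by
            refine pow_le_pow_right₀ hq1 ?_
            have h1 : τ * s * (8 * L) ≤ L * t * k₁ := by
              calc τ * s * (8 * L) ≤ τ * (2 * L * k₁) * (8 * L) := by gcongr
                _ = L * L ^ 2 * k₁ := by rw [hL]; ring
                _ ≤ L * t * k₁ := by gcongr
            have h2 : 6 * τ * t * k₁ * 8 = L * t * k₁ + 2 * L * t * k₁ := by rw [hL]; ring
            omega
        _ = (q ^ (6 * τ * t * k₁)) ^ 8 := by rw [← pow_mul]
    · calc (|r₁| ^ (2 * L * t)) ^ L = (|r₁| ^ (8 * L)) ^ (4 * τ * t) := by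
            rw [← pow_mul, ← pow_mul]; congr 1; rw [hL]; ring
        _ ≤ (q ^ k₁) ^ (4 * τ * t) := by gcongr
        _ = q ^ (4 * τ * t * k₁) := by rw [← pow_mul]; congr 1; ring
        _ ≤ q ^ (6 * τ * t * k₁) := by
            refine pow_le_pow_right₀ hq1 ?_
            gcongr
            norm_num
  have hlt : |G| < q ^ (k₁ * (t * L)) := by
    calc |G| ≤ R * ((p ^ k₁) ^ (4 * t) * max |p ^ s * r₂| (|r₁| ^ (2 * L * t)) ^ L) := hGle
      _ ≤ q ^ (τ * t * k₁) * (q ^ (4 * τ * t * k₁) * q ^ (6 * τ * t * k₁)) := by gcongr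
      _ = q ^ (11 * (τ * t * k₁)) := by rw [← pow_add, ← pow_add]; congr 1; ring
      _ < q ^ (k₁ * (t * L)) := by
          refine pow_lt_pow_right₀ (by omega) ?_
          have h1 : k₁ * (t * L) = 16 * (τ * t * k₁) := by rw [hL]; ring
          have h2 : 0 < τ * t * k₁ := by positivity
          omega
  exact hG0 (Int.eq_zero_of_abs_lt_dvd hQG hlt)

theorem ne_zero_of_pow_dvd_pow_sub {p q r : ℤ} {k : ℕ} (hcop : IsCoprime p q) (hq : 2 ≤ q)
    (hk : 1 ≤ k) (hd : q ^ k ∣ p ^ k - r) : r ≠ 0 := by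
  rintro rfl
  rw [sub_zero] at hd
  have h1 : IsUnit (q ^ k) := (hcop.pow (m := k) (n := k)).isUnit_of_dvd' hd dvd_rfl
  rw [isUnit_pow_iff (by omega), Int.isUnit_iff] at h1
  omega

theorem exists_forall_lt_abs_pow_of_dvd {p q : ℤ} (hcop : IsCoprime p q) (hq : 2 ≤ q)
    (hpq : q < p) : ∃ H K : ℕ, 0 < H ∧ ∀ k, 1 ≤ k → K ≤ k → ∀ r : ℤ, q ^ k ∣ p ^ k - r →
      q ^ k < |r| ^ H := by
  obtain ⟨τ, hτ⟩ : ∃ τ : ℕ, p ≤ q ^ τ := by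
    obtain ⟨τ, hτ⟩ := pow_unbounded_of_one_lt p (show 1 < q by omega)
    exact ⟨τ, hτ.le⟩
  have hτ0 : 0 < τ := by
    rcases Nat.eq_zero_or_pos τ with rfl | h
    · simp at hτ; omega
    · exact h
  set L := 16 * τ with hL
  by_cases hex : ∃ k₁, 1 ≤ k₁ ∧ 8 * L ^ 3 ≤ k₁ ∧ ∃ r : ℤ, q ^ k₁ ∣ p ^ k₁ - r ∧
      |r| ^ (8 * L) ≤ q ^ k₁
  · obtain ⟨k₁, h1, hk₁, r₁, hd₁, hs₁⟩ := hex
    refine ⟨8 * L, 2 * L * k₁ * L ^ 2, by omega, fun k hk hK r hd => ?_⟩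
    exact not_le.mp (not_two_small_residues hq hpq hτ hL hk₁ hK
      (ne_zero_of_pow_dvd_pow_sub hcop hq h1 hd₁) (ne_zero_of_pow_dvd_pow_sub hcop hq hk hd)
      hd₁ hd hs₁)
  · push Not at hex
    exact ⟨8 * L, 8 * L ^ 3, by omega, fun k hk hK r hd => hex k hk hK r hd⟩

/-- **The Baker–Coates theorem (1975) on fractional parts of powers of rationals.**
Let `p` and `q` be coprime rational integers with `p > q ≥ 2`. Then there exist a real
`η < 1` and a real `c > 0` such that for every integer `k ≥ 1` the distance from
`(p/q)^k` to the nearest integer is at least `c / q^(η k)`. -/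
theorem baker_coates (p q : ℤ) (hcop : IsCoprime p q) (hq : 2 ≤ q) (hpq : q < p) :
    ∃ η : ℝ, η < 1 ∧ ∃ c : ℝ, 0 < c ∧ ∀ k : ℕ, 1 ≤ k → ∀ m : ℤ,
      c / (q : ℝ) ^ (η * k) ≤ |((p : ℝ) / (q : ℝ)) ^ k - (m : ℝ)| := by
  obtain ⟨H, K, hH, hK⟩ := exists_forall_lt_abs_pow_of_dvd hcop hq hpq
  have hq1 : (1 : ℝ) ≤ q := by exact_mod_cast (by omega : (1 : ℤ) ≤ q)
  have hq0 : (0 : ℝ) < q := by linarith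
  have hH1 : (1 : ℝ) ≤ H := by exact_mod_cast hH
  have hη : 0 ≤ 1 - 1 / (H : ℝ) := by
    rw [sub_nonneg, div_le_one (by linarith)]
    exact hH1
  refine ⟨1 - 1 / H, by simpa using hH, ((q : ℝ) ^ K)⁻¹, by positivity, fun k hk m => ?_⟩
  have hr : ((p : ℝ) / q) ^ k - m = ((p ^ k - m * q ^ k : ℤ) : ℝ) / (q : ℝ) ^ k := by
    push_cast
    rw [div_pow]
    field_simp
  have hd : q ^ k ∣ p ^ k - (p ^ k - m * q ^ k) := ⟨m, by ring⟩
  have hpow : (1 : ℝ) ≤ (q : ℝ) ^ ((1 - 1 / (H : ℝ)) * k) :=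
    Real.one_le_rpow hq1 (by positivity)
  rw [hr, abs_div, abs_of_pos (pow_pos hq0 k)]
  set r : ℤ := p ^ k - m * q ^ k
  rcases lt_or_ge k K with hkK | hkK
  · have hr0 : r ≠ 0 := ne_zero_of_pow_dvd_pow_sub hcop hq hk hd
    have h1 : (1 : ℝ) ≤ |(r : ℝ)| := by exact_mod_cast Int.one_le_abs hr0
    calc ((q : ℝ) ^ K)⁻¹ / (q : ℝ) ^ ((1 - 1 / (H : ℝ)) * k) ≤ ((q : ℝ) ^ K)⁻¹ :=
          div_le_self (by positivity) hpow
      _ ≤ ((q : ℝ) ^ k)⁻¹ := by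
          gcongr
      _ ≤ |(r : ℝ)| / (q : ℝ) ^ k := by
          rw [inv_eq_one_div]
          gcongr
  · have h1 : ((q : ℝ) ^ k) ≤ |(r : ℝ)| ^ H := by
      have := (hK k hk hkK r hd).le
      exact_mod_cast this
    have h2 : (q : ℝ) ^ ((k : ℝ) / H) ≤ |(r : ℝ)| := by
      refine le_of_pow_le_pow_left₀ (n := H) (by omega) (abs_nonneg _) ?_
      rw [← Real.rpow_natCast, ← Real.rpow_mul hq0.le, div_mul_cancel₀ _ (by positivity),
        Real.rpow_natCast]
      exact h1
    calc ((q : ℝ) ^ K)⁻¹ / (q : ℝ) ^ ((1 - 1 / (H : ℝ)) * k)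
        ≤ 1 / (q : ℝ) ^ ((1 - 1 / (H : ℝ)) * k) := by
          gcongr
          exact inv_le_one_of_one_le₀ (one_le_pow₀ hq1)
      _ = (q : ℝ) ^ ((k : ℝ) / H) / (q : ℝ) ^ k := by
          rw [← Real.rpow_natCast (q : ℝ) k, ← Real.rpow_sub hq0, one_div, ← Real.rpow_neg hq0.le]
          congr 1
          field_simp
          ring
      _ ≤ |(r : ℝ)| / (q : ℝ) ^ k := by gcongr
end
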